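/- arXiv:1707.08944 — 5 statements merged into one kernel-verified Lean document; each statement's English description precedes it below -/
import Mathlib

section
/- Let n ≥ 2 and C₀′ > 0. Let Λ₁, Λ₂ ⊆ ℝⁿ be open, Φⱼ ∈ C²(Λⱼ) (j = 1,2), with 0 < ℋⱼ < ∞ and 0 < 𝒱 < ∞. Assume: (i) for every 𝔥 = (a,h) ∈ ℝ^{1+n}, the convex hull of Σ₁(𝔥) is contained in Λ₁ ∩ (h − Λ₂); (ii) sup_{ξ,ξ′∈Λ₁} |∇Φ₁(ξ) − ∇Φ₁(ξ′)| + sup_{η,η′∈Λ₂} |∇Φ₂(η) − ∇Φ₂(η′)| ≤ (C₀′/4) 𝒱; (iii) for j = 1,2, every 𝔥 ∈ ℝ^{1+n} and all ξ, ξ′ ∈ Σⱼ(𝔥), |∇Φⱼ(ξ) − ∇Φⱼ(ξ′) − ∇²Φⱼ(ξ)(ξ−ξ′)| ≤ (C₀′/4) ℋⱼ |ξ−ξ′|; (iv) (A1′): for every {j,k} = {1,2}, every ξ ∈ Λⱼ, η ∈ Λₖ and every v ∈ ℝⁿ with v·(∇Φⱼ(ξ) − ∇Φₖ(η)) = 0,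 one has |(∇²Φⱼ(ξ)v) ∧ (∇Φⱼ(ξ) − ∇Φₖ(η))| ≥ C₀′ ℋⱼ 𝒱 |v|. Then hypothesis (A1) holds with constant C₀ = C₀′/4, i.e. for every {j,k} = {1,2}, every 𝔥 ∈ ℝ^{1+n}, all ξ, ξ′ ∈ Σⱼ(𝔥) and all η ∈ Λₖ, |(∇Φⱼ(ξ) − ∇Φⱼ(ξ′)) ∧ (∇Φⱼ(ξ) − ∇Φₖ(η))| ≥ (C₀′/4) 𝒱 ℋⱼ |ξ − ξ′|. -/
open MeasureTheory Metric Set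
open scoped ENNReal RealInnerProductSpace NNReal

noncomputable section

abbrev Euc (n : ℕ) := EuclideanSpace ℝ (Fin n)

/-- `|x ∧ y| = (|x|²|y|² − (x·y)²)^{1/2}`. -/
def wedge {n : ℕ} (x y : Euc n) : ℝ :=
  Real.sqrt (‖x‖ ^ 2 * ‖y‖ ^ 2 - ⟪x, y⟫ ^ 2)

/-- The surface `Σⱼ(𝔥)` (with `Φj, Λj` in the first slots). -/
def SigmaSet {n : ℕ} (Φj Φk : Euc n → ℝ) (Λj Λk : Set (Euc n)) (a : ℝ) (h : Euc n) :
    Set (Euc n) :=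
  {ξ | ξ ∈ Λj ∧ h - ξ ∈ Λk ∧ Φj ξ + Φk (h - ξ) = a}

/-- The set of values `‖∇Φ₁(ξ) − ∇Φ₂(η)‖`, whose supremum is `𝒱`. -/
def gradDiffSet {n : ℕ} (Φ₁ Φ₂ : Euc n → ℝ) (Λ₁ Λ₂ : Set (Euc n)) : Set ℝ :=
  {v | ∃ ξ ∈ Λ₁, ∃ η ∈ Λ₂, v = ‖gradient Φ₁ ξ - gradient Φ₂ η‖}

/-- The set of operator norms of the Hessian, whose supremum is `ℋⱼ`. -/
def hessSet {n : ℕ} (Φ : Euc n → ℝ) (Λ : Set (Euc n)) : Set ℝ :=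
  {h | ∃ ξ ∈ Λ, h = ‖fderiv ℝ (gradient Φ) ξ‖}

/-- Hypothesis (A1) for the ordered pair `(j,k)`. -/
def A1pair {n : ℕ} (Φj Φk : Euc n → ℝ) (Λj Λk : Set (Euc n)) (Hj V C₀ : ℝ) : Prop :=
  ∀ (a : ℝ) (h : Euc n), ∀ ξ ∈ SigmaSet Φj Φk Λj Λk a h, ∀ ξ' ∈ SigmaSet Φj Φk Λj Λk a h,
    ∀ η ∈ Λk,
      C₀ * V * Hj * ‖ξ - ξ'‖ ≤
          wedge (gradient Φj ξ - gradient Φj ξ') (gradient Φj ξ - gradient Φk η) ∧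
        C₀ * ‖gradient Φj ξ - gradient Φj ξ'‖ ≤ Hj * ‖ξ - ξ'‖

/-- Hypothesis (A1) with constant `C₀`. -/
def A1 {n : ℕ} (Φ₁ Φ₂ : Euc n → ℝ) (Λ₁ Λ₂ : Set (Euc n)) (H₁ H₂ V C₀ : ℝ) : Prop :=
  A1pair Φ₁ Φ₂ Λ₁ Λ₂ H₁ V C₀ ∧ A1pair Φ₂ Φ₁ Λ₂ Λ₁ H₂ V C₀

/-- Hypothesis (A2) (for one phase) with constant `d₀`. -/
def A2 {n : ℕ} (Φ : Euc n → ℝ) (Λ : Set (Euc n)) (H V d₀ : ℝ) : Prop :=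
  ContDiffOn ℝ (5 * n) Φ Λ ∧
    (∀ m : ℕ, 3 ≤ m → m ≤ 5 * n → ∀ ξ ∈ Λ,
      ‖iteratedFDerivWithin ℝ m Φ Λ ξ‖ ≤ d₀ ^ (2 - (m : ℝ)) * H) ∧
    d₀ * H ≤ V

/-- The `Φ`-wave with datum `g`. -/
def wave {n : ℕ} {F : Type*} [NormedAddCommGroup F] [NormedSpace ℂ F]
    (Φ : Euc n → ℝ) (g : Euc n → F) (t : ℝ) (x : Euc n) : F :=
  ∫ ξ, Complex.exp (Complex.I * ((t * Φ ξ + ⟪x, ξ⟫ : ℝ) : ℂ)) • g ξ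

/-- The mixed norm `‖F‖_{L^q_t L^r_x(Ω)}` (of a nonnegative extended-real valued `F`). -/
def mixedNorm {n : ℕ} (q r : ℝ) (Ω : Set (ℝ × Euc n)) (F : ℝ × Euc n → ℝ≥0∞) : ℝ≥0∞ :=
  (∫⁻ t : ℝ, (∫⁻ x : Euc n, Ω.indicator (fun p => F p ^ r) (t, x)) ^ (q / r)) ^ (1 / q)

/-- The (extended-real valued) `L^r` norm of `g`. -/
def eLr {n : ℕ} {F : Type*} [NormedAddCommGroup F] (r : ℝ) (g : Euc n → F) : ℝ≥0∞ :=
  (∫⁻ ξ, (‖g ξ‖₊ : ℝ≥0∞) ^ r) ^ (1 / r)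

/-- The quantity `𝐝[S₁, S₂]`. -/
def dSep {n : ℕ} (Φ₁ Φ₂ : Euc n → ℝ) (Λ₁ Λ₂ S₁ S₂ : Set (Euc n)) : ℝ≥0∞ :=
  ⨆ (a : ℝ) (h : Euc n),
    (μH[(n : ℝ) - 1] (SigmaSet Φ₁ Φ₂ Λ₁ Λ₂ a h ∩ S₁ ∩ {ξ | h - ξ ∈ S₂})) ^ (((n : ℝ) - 1)⁻¹)

end

lemma wedge_mul_norm {n : ℕ} (x y : Euc n) :
    wedge x y * ‖y‖ = ‖‖y‖ ^ 2 • x - ⟪x, y⟫ • y‖ := by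
  have hcs : 0 ≤ ‖x‖ ^ 2 * ‖y‖ ^ 2 - ⟪x, y⟫ ^ 2 := by
    have h := abs_real_inner_le_norm x y
    have := sq_le_sq' (by linarith [abs_nonneg ⟪x, y⟫, mul_nonneg (norm_nonneg x) (norm_nonneg y)]) h
    rw [sq_abs] at this
    nlinarith
  refine (sq_eq_sq₀ (mul_nonneg (Real.sqrt_nonneg _) (norm_nonneg _)) (norm_nonneg _)).1 ?_
  rw [mul_pow, Real.sq_sqrt hcs, norm_sub_sq_real, norm_smul, norm_smul,
    real_inner_smul_left, real_inner_smul_right, mul_pow, mul_pow]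
  simp only [Real.norm_eq_abs, sq_abs]
  ring

lemma wedge_zero_right {n : ℕ} (x : Euc n) : wedge x 0 = 0 := by
  simp [wedge]

lemma wedge_add_le {n : ℕ} (x z y : Euc n) : wedge (x + z) y ≤ wedge x y + wedge z y := by
  rcases eq_or_ne y 0 with rfl | hy
  · simp [wedge_zero_right]
  · refine le_of_mul_le_mul_right ?_ (norm_pos_iff.2 hy)
    rw [add_mul, wedge_mul_norm, wedge_mul_norm, wedge_mul_norm]
    refine le_trans (le_of_eq ?_) (norm_add_le _ _)
    rw [inner_add_left]
    congr 1
    module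

lemma wedge_le_norm_mul_norm {n : ℕ} (x y : Euc n) : wedge x y ≤ ‖x‖ * ‖y‖ := by
  refine Real.sqrt_le_iff.2 ⟨by positivity, ?_⟩
  nlinarith [sq_nonneg ⟪x, y⟫]

lemma exists_ne_zero_inner_eq_zero {n : ℕ} (hn : 2 ≤ n) (w : Euc n) :
    ∃ v : Euc n, v ≠ 0 ∧ ⟪v, w⟫ = 0 := by
  have hne : (Submodule.span ℝ {w})ᗮ ≠ ⊥ := by
    intro h
    have h1 := Submodule.finrank_add_finrank_orthogonal (Submodule.span ℝ {w})
    have h2 : Module.finrank ℝ (Submodule.span ℝ {w}) ≤ 1 := by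
      simpa using finrank_span_le_card (R := ℝ) ({w} : Set (Euc n))
    rw [h, finrank_bot, finrank_euclideanSpace_fin] at h1
    omega
  obtain ⟨v, hv, hv0⟩ := Submodule.exists_mem_ne_zero_of_ne_bot hne
  refine ⟨v, hv0, ?_⟩
  rw [real_inner_comm]
  exact Submodule.mem_orthogonal_singleton_iff_inner_right.1 hv

/-- A lower bound for `|A v ∧ w|` on the hyperplane orthogonal to `w` persists for vectors `v` that
are almost orthogonal to `w` and for `g` close to `A v`. -/
lemma wedge_lower_bound_of_almost_orthogonal {n : ℕ} (hn : 2 ≤ n) {A : Euc n →L[ℝ] Euc n}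
    {g w v : Euc n} {C H V : ℝ} (hC : 0 < C) (hH0 : 0 < H) (hV0 : 0 < V)
    (hA : ‖A‖ ≤ H) (hw : ‖w‖ ≤ V)
    (hg : ‖g - A v‖ ≤ C / 4 * H * ‖v‖) (hvw : |⟪v, w⟫| ≤ C / 4 * V * ‖v‖)
    (hloc : ∀ u : Euc n, ⟪u, w⟫ = 0 → C * H * V * ‖u‖ ≤ wedge (A u) w) :
    C / 4 * V * H * ‖v‖ ≤ wedge g w := by
  have hAle : ∀ u : Euc n, ‖A u‖ ≤ H * ‖u‖ := fun u => A.le_of_opNorm_le hA u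
  have hwlow : C * V ≤ ‖w‖ := by
    obtain ⟨u, hu0, hu⟩ := exists_ne_zero_inner_eq_zero hn w
    have hupos : 0 < H * ‖u‖ := mul_pos hH0 (norm_pos_iff.2 hu0)
    have h1 := (hloc u hu).trans (wedge_le_norm_mul_norm _ _)
    have h2 := mul_le_mul_of_nonneg_right (hAle u) (norm_nonneg w)
    refine le_of_mul_le_mul_left ?_ hupos
    linarith
  have hwpos : 0 < ‖w‖ := (mul_pos hC hV0).trans_le hwlow
  set p : Euc n := (⟪v, w⟫ / ‖w‖ ^ 2) • w with hp
  have hpn : ‖p‖ * ‖w‖ = |⟪v, w⟫| := by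
    rw [hp, norm_smul, Real.norm_eq_abs, abs_div, abs_of_nonneg (sq_nonneg ‖w‖)]
    field_simp
  have horth : ⟪v - p, w⟫ = 0 := by
    rw [inner_sub_left, hp, real_inner_smul_left, real_inner_self_eq_norm_sq]
    field_simp
    ring
  have hple : ‖p‖ ≤ ‖v‖ / 4 := by
    refine le_of_mul_le_mul_right ?_ hwpos
    rw [hpn]
    have := mul_le_mul_of_nonneg_right hwlow (norm_nonneg v)
    linarith
  have hv0 : 3 / 4 * ‖v‖ ≤ ‖v - p‖ := by
    have := norm_sub_norm_le v p
    linarith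
  have hmain := hloc _ horth
  have hCHV : 0 < C * H * V := by positivity
  have h1 := mul_le_mul_of_nonneg_left hv0 hCHV.le
  have hdecomp : A (v - p) = (g + -(g - A v)) + -(A p) := by
    rw [map_sub]
    abel
  have h2 := wedge_add_le (g + -(g - A v)) (-(A p)) w
  have h3 := wedge_add_le g (-(g - A v)) w
  have h4 : wedge (-(g - A v)) w ≤ C / 4 * H * ‖v‖ * V := by
    refine (wedge_le_norm_mul_norm _ _).trans ?_
    rw [norm_neg]
    exact mul_le_mul hg hw (norm_nonneg _) (by positivity)
  have h5 : wedge (-(A p)) w ≤ H * (C / 4 * V * ‖v‖) := by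
    refine (wedge_le_norm_mul_norm _ _).trans ?_
    rw [norm_neg]
    calc ‖A p‖ * ‖w‖ ≤ H * ‖p‖ * ‖w‖ := mul_le_mul_of_nonneg_right (hAle p) (norm_nonneg w)
      _ = H * |⟪v, w⟫| := by rw [mul_assoc, hpn]
      _ ≤ _ := mul_le_mul_of_nonneg_left hvw hH0.le
  rw [hdecomp] at hmain
  linarith

lemma exists_mem_segment_inner_gradient_eq_zero {n : ℕ} {Φ Ψ : Euc n → ℝ} {Λ Λ' : Set (Euc n)}
    (hΛ : IsOpen Λ) (hΛ' : IsOpen Λ') (hΦ : ContDiffOn ℝ 2 Φ Λ) (hΨ : ContDiffOn ℝ 2 Ψ Λ')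
    {h ξ ξ' : Euc n} (hseg : ∀ ζ ∈ segment ℝ ξ' ξ, ζ ∈ Λ ∧ h - ζ ∈ Λ')
    (heq : Φ ξ + Ψ (h - ξ) = Φ ξ' + Ψ (h - ξ')) :
    ∃ ζ ∈ segment ℝ ξ' ξ, ⟪ξ - ξ', gradient Φ ζ - gradient Ψ (h - ζ)⟫ = 0 := by
  have hderiv : ∀ ζ ∈ segment ℝ ξ' ξ, HasFDerivWithinAt (fun ζ => Φ ζ + Ψ (h - ζ))
      (fderiv ℝ Φ ζ + (fderiv ℝ Ψ (h - ζ)).comp (-ContinuousLinearMap.id ℝ (Euc n)))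
      (segment ℝ ξ' ξ) ζ := by
    intro ζ hζ
    obtain ⟨h1, h2⟩ := hseg ζ hζ
    have hd1 : HasFDerivAt Φ (fderiv ℝ Φ ζ) ζ :=
      ((hΦ.differentiableOn (by norm_num)).differentiableAt (hΛ.mem_nhds h1)).hasFDerivAt
    have hd2 : HasFDerivAt Ψ (fderiv ℝ Ψ (h - ζ)) (h - ζ) :=
      ((hΨ.differentiableOn (by norm_num)).differentiableAt (hΛ'.mem_nhds h2)).hasFDerivAt
    have hd3 : HasFDerivAt (fun ζ : Euc n => h - ζ) (-ContinuousLinearMap.id ℝ (Euc n)) ζ :=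
      (hasFDerivAt_id ζ).const_sub h
    exact (hd1.add (hd2.comp ζ hd3)).hasFDerivWithinAt
  obtain ⟨ζ, hζ, hmv⟩ := domain_mvt hderiv (convex_segment ξ' ξ)
    (left_mem_segment ℝ ξ' ξ) (right_mem_segment ℝ ξ' ξ)
  refine ⟨ζ, hζ, ?_⟩
  have e1 : ∀ (f : Euc n → ℝ) (x u : Euc n), ⟪u, gradient f x⟫ = fderiv ℝ f x u := by
    intro f x u
    rw [real_inner_comm, gradient, InnerProductSpace.toDual_symm_apply]
  rw [inner_sub_right, e1, e1]
  simp only [add_apply, ContinuousLinearMap.comp_apply, neg_apply, ContinuousLinearMap.id_apply, map_neg] at hmv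
  linarith

lemma wedge_gradient_sub_lower_bound {n : ℕ} (hn : 2 ≤ n) {C V H : ℝ} (hC : 0 < C) (hV0 : 0 < V)
    (hH0 : 0 < H) {Φ Ψ : Euc n → ℝ} {Λ Λ' : Set (Euc n)} (hΛ : IsOpen Λ) (hΛ' : IsOpen Λ')
    (hΦ : ContDiffOn ℝ 2 Φ Λ) (hΨ : ContDiffOn ℝ 2 Ψ Λ')
    (hV : ∀ ξ ∈ Λ, ∀ η ∈ Λ', ‖gradient Φ ξ - gradient Ψ η‖ ≤ V)
    (hH : ∀ ξ ∈ Λ, ‖fderiv ℝ (gradient Φ) ξ‖ ≤ H)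
    (hsmall : ∀ ξ ∈ Λ, ∀ ξ' ∈ Λ, ∀ η ∈ Λ', ∀ η' ∈ Λ',
      ‖gradient Φ ξ - gradient Φ ξ'‖ + ‖gradient Ψ η - gradient Ψ η'‖ ≤ C / 4 * V)
    (hloc : ∀ ξ ∈ Λ, ∀ η ∈ Λ', ∀ v : Euc n, ⟪v, gradient Φ ξ - gradient Ψ η⟫ = 0 →
      C * H * V * ‖v‖ ≤ wedge (fderiv ℝ (gradient Φ) ξ v) (gradient Φ ξ - gradient Ψ η))
    {h ξ ξ' η : Euc n} (hseg : ∀ ζ ∈ segment ℝ ξ' ξ, ζ ∈ Λ ∧ h - ζ ∈ Λ')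
    (heq : Φ ξ + Ψ (h - ξ) = Φ ξ' + Ψ (h - ξ'))
    (hhess : ‖gradient Φ ξ - gradient Φ ξ' - fderiv ℝ (gradient Φ) ξ (ξ - ξ')‖ ≤
      C / 4 * H * ‖ξ - ξ'‖) (hη : η ∈ Λ') :
    C / 4 * V * H * ‖ξ - ξ'‖ ≤
      wedge (gradient Φ ξ - gradient Φ ξ') (gradient Φ ξ - gradient Ψ η) := by
  have hξ : ξ ∈ Λ := (hseg ξ (right_mem_segment ℝ ξ' ξ)).1
  obtain ⟨ζ, hζ, hperp⟩ := exists_mem_segment_inner_gradient_eq_zero hΛ hΛ' hΦ hΨ hseg heq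
  obtain ⟨hζ1, hζ2⟩ := hseg ζ hζ
  refine wedge_lower_bound_of_almost_orthogonal hn hC hH0 hV0 (hH ξ hξ) (hV ξ hξ η hη) hhess ?_
    (hloc ξ hξ η hη)
  have hsplit : gradient Φ ξ - gradient Ψ η = (gradient Φ ζ - gradient Ψ (h - ζ)) +
      ((gradient Φ ξ - gradient Φ ζ) + (gradient Ψ (h - ζ) - gradient Ψ η)) := by
    abel
  rw [hsplit, inner_add_right, hperp, zero_add]
  refine (abs_real_inner_le_norm _ _).trans ?_
  rw [mul_comm]
  exact mul_le_mul_of_nonneg_right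
    ((norm_add_le _ _).trans (hsmall ξ hξ ζ hζ1 _ hζ2 η hη)) (norm_nonneg _)

/-- Lemma 2.1 (the local condition (A1′) implies the global condition (A1)). -/
theorem local_implies_global_A1 (n : ℕ) (hn : 2 ≤ n) (C₀' : ℝ) (hC₀' : 0 < C₀')
    (Λ₁ Λ₂ : Set (Euc n)) (Φ₁ Φ₂ : Euc n → ℝ) (V H₁ H₂ : ℝ)
    (hΛ₁ : IsOpen Λ₁) (hΛ₂ : IsOpen Λ₂)
    (hΦ₁ : ContDiffOn ℝ 2 Φ₁ Λ₁) (hΦ₂ : ContDiffOn ℝ 2 Φ₂ Λ₂)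
    (hV : IsLUB (gradDiffSet Φ₁ Φ₂ Λ₁ Λ₂) V) (hV0 : 0 < V)
    (hH₁ : IsLUB (hessSet Φ₁ Λ₁) H₁) (hH₂ : IsLUB (hessSet Φ₂ Λ₂) H₂)
    (hH₁0 : 0 < H₁) (hH₂0 : 0 < H₂)
    -- (i) convex hulls of the intersection surfaces stay inside the domains
    (hconv : ∀ (a : ℝ) (h : Euc n),
      convexHull ℝ (SigmaSet Φ₁ Φ₂ Λ₁ Λ₂ a h) ⊆ Λ₁ ∩ {ξ | h - ξ ∈ Λ₂})
    -- (ii) small variation of the gradients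
    (hsmall : ∀ ξ ∈ Λ₁, ∀ ξ' ∈ Λ₁, ∀ η ∈ Λ₂, ∀ η' ∈ Λ₂,
      ‖gradient Φ₁ ξ - gradient Φ₁ ξ'‖ + ‖gradient Φ₂ η - gradient Φ₂ η'‖ ≤ C₀' / 4 * V)
    -- (iii) small variation of the Hessians on the surfaces
    (hhess₁ : ∀ (a : ℝ) (h : Euc n), ∀ ξ ∈ SigmaSet Φ₁ Φ₂ Λ₁ Λ₂ a h,
      ∀ ξ' ∈ SigmaSet Φ₁ Φ₂ Λ₁ Λ₂ a h,
        ‖gradient Φ₁ ξ - gradient Φ₁ ξ' - fderiv ℝ (gradient Φ₁) ξ (ξ - ξ')‖ ≤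
          C₀' / 4 * H₁ * ‖ξ - ξ'‖)
    (hhess₂ : ∀ (a : ℝ) (h : Euc n), ∀ ξ ∈ SigmaSet Φ₂ Φ₁ Λ₂ Λ₁ a h,
      ∀ ξ' ∈ SigmaSet Φ₂ Φ₁ Λ₂ Λ₁ a h,
        ‖gradient Φ₂ ξ - gradient Φ₂ ξ' - fderiv ℝ (gradient Φ₂) ξ (ξ - ξ')‖ ≤
          C₀' / 4 * H₂ * ‖ξ - ξ'‖)
    -- (iv) the local condition (A1')
    (hA1'₁ : ∀ ξ ∈ Λ₁, ∀ η ∈ Λ₂, ∀ v : Euc n,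
      ⟪v, gradient Φ₁ ξ - gradient Φ₂ η⟫ = 0 →
        C₀' * H₁ * V * ‖v‖ ≤
          wedge (fderiv ℝ (gradient Φ₁) ξ v) (gradient Φ₁ ξ - gradient Φ₂ η))
    (hA1'₂ : ∀ η ∈ Λ₂, ∀ ξ ∈ Λ₁, ∀ v : Euc n,
      ⟪v, gradient Φ₂ η - gradient Φ₁ ξ⟫ = 0 →
        C₀' * H₂ * V * ‖v‖ ≤
          wedge (fderiv ℝ (gradient Φ₂) η v) (gradient Φ₂ η - gradient Φ₁ ξ)) :
    (∀ (a : ℝ) (h : Euc n), ∀ ξ ∈ SigmaSet Φ₁ Φ₂ Λ₁ Λ₂ a h,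
      ∀ ξ' ∈ SigmaSet Φ₁ Φ₂ Λ₁ Λ₂ a h, ∀ η ∈ Λ₂,
        C₀' / 4 * V * H₁ * ‖ξ - ξ'‖ ≤
          wedge (gradient Φ₁ ξ - gradient Φ₁ ξ') (gradient Φ₁ ξ - gradient Φ₂ η)) ∧
    (∀ (a : ℝ) (h : Euc n), ∀ ξ ∈ SigmaSet Φ₂ Φ₁ Λ₂ Λ₁ a h,
      ∀ ξ' ∈ SigmaSet Φ₂ Φ₁ Λ₂ Λ₁ a h, ∀ η ∈ Λ₁,
        C₀' / 4 * V * H₂ * ‖ξ - ξ'‖ ≤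
          wedge (gradient Φ₂ ξ - gradient Φ₂ ξ') (gradient Φ₂ ξ - gradient Φ₁ η)) := by
  have hV' : ∀ ξ ∈ Λ₁, ∀ η ∈ Λ₂, ‖gradient Φ₁ ξ - gradient Φ₂ η‖ ≤ V :=
    fun ξ hξ η hη => hV.1 ⟨ξ, hξ, η, hη, rfl⟩
  refine ⟨fun a h ξ hξ ξ' hξ' η hη => ?_, fun a h ξ hξ ξ' hξ' η hη => ?_⟩
  · exact wedge_gradient_sub_lower_bound hn hC₀' hV0 hH₁0 hΛ₁ hΛ₂ hΦ₁ hΦ₂ hV'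
      (fun ξ hξ => hH₁.1 ⟨ξ, hξ, rfl⟩) hsmall hA1'₁
      (fun ζ hζ => hconv a h (segment_subset_convexHull hξ' hξ hζ))
      (hξ.2.2.trans hξ'.2.2.symm) (hhess₁ a h ξ hξ ξ' hξ') hη
  · have hrefl : ∀ x ∈ SigmaSet Φ₂ Φ₁ Λ₂ Λ₁ a h, h - x ∈ SigmaSet Φ₁ Φ₂ Λ₁ Λ₂ a h := by
      rintro x ⟨hx1, hx2, hx3⟩
      refine ⟨hx2, ?_, ?_⟩
      · rwa [sub_sub_cancel]
      · rw [sub_sub_cancel, add_comm, hx3]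
    refine wedge_gradient_sub_lower_bound hn hC₀' hV0 hH₂0 hΛ₂ hΛ₁ hΦ₂ hΦ₁
      (fun η hη ξ hξ => norm_sub_rev (gradient Φ₁ ξ) (gradient Φ₂ η) ▸ hV' ξ hξ η hη)
      (fun ξ hξ => hH₂.1 ⟨ξ, hξ, rfl⟩)
      (fun ξ hξ ξ' hξ' η hη η' hη' => add_comm _ _ |>.trans_le (hsmall η hη η' hη' ξ hξ ξ' hξ'))
      hA1'₂ (fun ζ hζ => ?_)
      (hξ.2.2.trans hξ'.2.2.symm) (hhess₂ a h ξ hξ ξ' hξ') hη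
    have hmem : h - ζ ∈ segment ℝ (h - ξ') (h - ξ) := by
      obtain ⟨s, t, hs, ht, hst, rfl⟩ := hζ
      refine ⟨s, t, hs, ht, hst, ?_⟩
      obtain rfl : s = 1 - t := by linarith
      module
    have := hconv a h (segment_subset_convexHull (hrefl ξ' hξ') (hrefl ξ hξ) hmem)
    exact ⟨by simpa using this.2, this.1⟩
end

section
/- Let n ≥ 2 and C₀⁽¹⁾, C₀⁽²⁾ > 0. Let Λ₁, Λ₂ ⊆ ℝⁿ be open, Φⱼ ∈ C²(Λⱼ) (j = 1,2), with 0 < ℋⱼ < ∞ and 0 < 𝒱 < ∞. Assume: (i) for every 𝔥 = (a,h) ∈ ℝ^{1+n}, the convex hull of Σ₁(𝔥) is contained in Λ₁ ∩ (h − Λ₂); (ii) sup_{ξ,ξ′∈Λ₁} |∇Φ₁(ξ) − ∇Φ₁(ξ′)| + sup_{η,η′∈Λ₂} |∇Φ₂(η) − ∇Φ₂(η′)| ≤ (C₀⁽¹⁾C₀⁽²⁾/2) 𝒱; (iii) curvature: for {j,k} = {1,2}, every 𝔥 ∈ ℝ^{1+n} and all ξ, ξ′ ∈ Σⱼ(𝔥),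 |(∇Φⱼ(ξ) − ∇Φⱼ(ξ′))·(ξ − ξ′)| ≥ C₀⁽¹⁾ ℋⱼ |ξ − ξ′|²; (iv) transversality: |∇Φ₁(ξ) − ∇Φ₂(η)| ≥ C₀⁽²⁾ 𝒱 for all ξ ∈ Λ₁ and η ∈ Λ₂. Then hypothesis (A1) holds with constant C₀ = C₀⁽¹⁾C₀⁽²⁾/2, i.e. for every {j,k} = {1,2}, every 𝔥 ∈ ℝ^{1+n}, all ξ, ξ′ ∈ Σⱼ(𝔥) and all η ∈ Λₖ, |(∇Φⱼ(ξ) − ∇Φⱼ(ξ′)) ∧ (∇Φⱼ(ξ) − ∇Φₖ(η))| ≥ (C₀⁽¹⁾C₀⁽²⁾/2) 𝒱 ℋⱼ |ξ − ξ′|. -/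
open MeasureTheory Metric Set
open scoped ENNReal RealInnerProductSpace NNReal

/-- `|x ∧ y|` is `|x|` times the length of the component of `y` orthogonal to `x`. -/
lemma wedge_eq_norm_mul_norm_sub {n : ℕ} (x y : Euc n) :
    wedge x y = ‖x‖ * ‖y - (⟪x, y⟫ / ‖x‖ ^ 2) • x‖ := by
  rcases eq_or_ne x 0 with rfl | hx
  · simp [wedge]
  have hx' : ‖x‖ ≠ 0 := norm_ne_zero_iff.mpr hx
  rw [wedge, ← Real.sqrt_sq (mul_nonneg (norm_nonneg x) (norm_nonneg _)), mul_pow,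
    norm_sub_sq_real, norm_smul, real_inner_smul_right, real_inner_comm y x, mul_pow,
    Real.norm_eq_abs, sq_abs]
  congr 1
  field_simp
  ring

lemma wedge_comm {n : ℕ} (x y : Euc n) : wedge x y = wedge y x := by
  rw [wedge, wedge, real_inner_comm, mul_comm]

lemma wedge_add_right_le {n : ℕ} (x y z : Euc n) :
    wedge x (y + z) ≤ wedge x y + wedge x z := by
  simp only [wedge_eq_norm_mul_norm_sub, ← mul_add]
  refine mul_le_mul_of_nonneg_left ?_ (norm_nonneg _)
  refine (norm_add_le _ _).trans_eq' (congrArg _ ?_)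
  rw [inner_add_right, add_div, add_smul]
  abel

lemma abs_inner_mul_norm_le_wedge_mul_norm {n : ℕ} {x y u : Euc n} (h : ⟪y, u⟫ = 0) :
    |⟪x, u⟫| * ‖y‖ ≤ wedge x y * ‖u‖ := by
  rw [wedge_comm, wedge_eq_norm_mul_norm_sub]
  have h1 : ⟪x - (⟪y, x⟫ / ‖y‖ ^ 2) • y, u⟫ = ⟪x, u⟫ := by
    rw [inner_sub_left, real_inner_smul_left, h, mul_zero, sub_zero]
  have h2 := abs_real_inner_le_norm (x - (⟪y, x⟫ / ‖y‖ ^ 2) • y) u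
  rw [h1] at h2
  nlinarith [mul_le_mul_of_nonneg_left h2 (norm_nonneg y)]

lemma differentiableOn_gradient {n : ℕ} {Φ : Euc n → ℝ} {Λ : Set (Euc n)} (hΛ : IsOpen Λ)
    (hΦ : ContDiffOn ℝ 2 Φ Λ) : DifferentiableOn ℝ (gradient Φ) Λ :=
  (InnerProductSpace.toDual ℝ (Euc n)).symm.differentiable.comp_differentiableOn
    ((hΦ.fderiv_of_isOpen hΛ (m := 1) (by norm_num)).differentiableOn (by norm_num))

lemma norm_gradient_sub_le {n : ℕ} {Φ : Euc n → ℝ} {Λ : Set (Euc n)} {H : ℝ} (hΛ : IsOpen Λ)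
    (hΦ : ContDiffOn ℝ 2 Φ Λ) (hH : H ∈ upperBounds (hessSet Φ Λ)) {ξ ξ' : Euc n}
    (hseg : segment ℝ ξ ξ' ⊆ Λ) :
    ‖gradient Φ ξ - gradient Φ ξ'‖ ≤ H * ‖ξ - ξ'‖ :=
  (convex_segment ξ ξ').norm_image_sub_le_of_norm_hasFDerivWithin_le
    (f' := fderiv ℝ (gradient Φ))
    (fun _ hζ => (((differentiableOn_gradient hΛ hΦ).differentiableAt
      (hΛ.mem_nhds (hseg hζ))).hasFDerivAt).hasFDerivWithinAt)
    (fun ζ hζ => hH ⟨ζ, hseg hζ, rfl⟩)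
    (right_mem_segment ℝ ξ ξ') (left_mem_segment ℝ ξ ξ')

/-- Rolle's theorem for `ζ ↦ Φj ζ + Φk (h - ζ)` along a segment. -/
lemma exists_inner_gradient_sub_gradient_eq_zero {n : ℕ} {Φj Φk : Euc n → ℝ}
    {Λj Λk : Set (Euc n)} (hΛj : IsOpen Λj) (hΛk : IsOpen Λk)
    (hΦj : DifferentiableOn ℝ Φj Λj) (hΦk : DifferentiableOn ℝ Φk Λk) {h ξ ξ' : Euc n}
    (hseg : segment ℝ ξ ξ' ⊆ Λj ∩ {ζ | h - ζ ∈ Λk})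
    (heq : Φj ξ + Φk (h - ξ) = Φj ξ' + Φk (h - ξ')) :
    ∃ ζ ∈ segment ℝ ξ ξ', ⟪gradient Φj ζ - gradient Φk (h - ζ), ξ - ξ'⟫ = 0 := by
  have hder : ∀ ζ ∈ segment ℝ ξ ξ', HasFDerivWithinAt (fun ζ => Φj ζ + Φk (h - ζ))
      (fderiv ℝ Φj ζ - fderiv ℝ Φk (h - ζ)) (segment ℝ ξ ξ') ζ := fun ζ hζ => by
    have h1 := (hΦj.differentiableAt (hΛj.mem_nhds (hseg hζ).1)).hasFDerivAt
    have h2 := (hΦk.differentiableAt (hΛk.mem_nhds (hseg hζ).2)).hasFDerivAt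
    have h3 := h2.comp ζ ((hasFDerivAt_id ζ).const_sub h)
    refine ((h1.add h3).congr_fderiv ?_).hasFDerivWithinAt
    ext v
    simp [sub_eq_add_neg]
  obtain ⟨ζ, hζ, hz⟩ := domain_mvt hder (convex_segment ξ ξ')
    (right_mem_segment ℝ ξ ξ') (left_mem_segment ℝ ξ ξ')
  refine ⟨ζ, (convex_segment ξ ξ').segment_subset (right_mem_segment ℝ ξ ξ')
    (left_mem_segment ℝ ξ ξ') hζ, ?_⟩
  simp only [heq, sub_self, sub_apply] at hz
  rw [inner_sub_left, gradient, gradient, InnerProductSpace.toDual_symm_apply,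
    InnerProductSpace.toDual_symm_apply]
  exact hz.symm

lemma le_wedge_gradient_sub_gradient {n : ℕ} {C₁ C₂ V H : ℝ} {Φj Φk : Euc n → ℝ}
    {Λj Λk : Set (Euc n)} (hC₁ : 0 < C₁) (hH0 : 0 < H)
    (hΛj : IsOpen Λj) (hΛk : IsOpen Λk)
    (hΦj : ContDiffOn ℝ 2 Φj Λj) (hΦk : ContDiffOn ℝ 2 Φk Λk)
    (hH : H ∈ upperBounds (hessSet Φj Λj))
    (hsmall : ∀ ξ ∈ Λj, ∀ ξ' ∈ Λj, ∀ η ∈ Λk, ∀ η' ∈ Λk,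
      ‖gradient Φj ξ - gradient Φj ξ'‖ + ‖gradient Φk η - gradient Φk η'‖ ≤ C₁ * C₂ / 2 * V)
    (htrans : ∀ ξ ∈ Λj, ∀ η ∈ Λk, C₂ * V ≤ ‖gradient Φj ξ - gradient Φk η‖)
    {h ξ ξ' η : Euc n} (hseg : segment ℝ ξ ξ' ⊆ Λj ∩ {ζ | h - ζ ∈ Λk})
    (heq : Φj ξ + Φk (h - ξ) = Φj ξ' + Φk (h - ξ'))
    (hcurv : C₁ * H * ‖ξ - ξ'‖ ^ 2 ≤ |⟪gradient Φj ξ - gradient Φj ξ', ξ - ξ'⟫|)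
    (hη : η ∈ Λk) :
    C₁ * C₂ / 2 * V * H * ‖ξ - ξ'‖ ≤
      wedge (gradient Φj ξ - gradient Φj ξ') (gradient Φj ξ - gradient Φk η) := by
  rcases eq_or_ne ξ ξ' with rfl | hne
  · simp [wedge]
  have hu : 0 < ‖ξ - ξ'‖ := norm_pos_iff.mpr (sub_ne_zero.mpr hne)
  obtain ⟨ζ, hζ, hz⟩ := exists_inner_gradient_sub_gradient_eq_zero hΛj hΛk
    (hΦj.differentiableOn (by norm_num)) (hΦk.differentiableOn (by norm_num)) hseg heq
  set D := gradient Φj ξ - gradient Φj ξ'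
  set N := gradient Φj ζ - gradient Φk (h - ζ)
  set E := (gradient Φj ζ - gradient Φj ξ) + (gradient Φk η - gradient Φk (h - ζ))
  have hNE : N = (gradient Φj ξ - gradient Φk η) + E := by simp only [N, E]; abel
  have hD : ‖D‖ ≤ H * ‖ξ - ξ'‖ :=
    norm_gradient_sub_le hΛj hΦj hH (hseg.trans inter_subset_left)
  have hE : ‖E‖ ≤ C₁ * C₂ / 2 * V :=
    (norm_add_le _ _).trans (hsmall _ (hseg hζ).1 _ (hseg (left_mem_segment ℝ ξ ξ')).1
      _ hη _ (hseg hζ).2)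
  have hN : C₁ * H * ‖ξ - ξ'‖ * (C₂ * V) ≤ wedge D N := by
    refine le_of_mul_le_mul_right ?_ hu
    calc C₁ * H * ‖ξ - ξ'‖ * (C₂ * V) * ‖ξ - ξ'‖
        = C₁ * H * ‖ξ - ξ'‖ ^ 2 * (C₂ * V) := by ring
      _ ≤ C₁ * H * ‖ξ - ξ'‖ ^ 2 * ‖N‖ := by
          gcongr
          exact htrans _ (hseg hζ).1 _ (hseg hζ).2
      _ ≤ |⟪D, ξ - ξ'⟫| * ‖N‖ := by gcongr
      _ ≤ wedge D N * ‖ξ - ξ'‖ := abs_inner_mul_norm_le_wedge_mul_norm hz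
  have hDE : wedge D E ≤ H * ‖ξ - ξ'‖ * (C₁ * C₂ / 2 * V) :=
    (wedge_le_norm_mul_norm D E).trans (by gcongr)
  have htri := wedge_add_right_le D (gradient Φj ξ - gradient Φk η) E
  rw [← hNE] at htri
  linarith


/-- Lemma 2.2 (curvature + transversality imply the condition (A1)). -/
theorem curvature_transversality_implies_A1 (n : ℕ) (hn : 2 ≤ n) (C₁ C₂ : ℝ)
    (hC₁ : 0 < C₁) (hC₂ : 0 < C₂)
    (Λ₁ Λ₂ : Set (Euc n)) (Φ₁ Φ₂ : Euc n → ℝ) (V H₁ H₂ : ℝ)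
    (hΛ₁ : IsOpen Λ₁) (hΛ₂ : IsOpen Λ₂)
    (hΦ₁ : ContDiffOn ℝ 2 Φ₁ Λ₁) (hΦ₂ : ContDiffOn ℝ 2 Φ₂ Λ₂)
    (hV : IsLUB (gradDiffSet Φ₁ Φ₂ Λ₁ Λ₂) V) (hV0 : 0 < V)
    (hH₁ : IsLUB (hessSet Φ₁ Λ₁) H₁) (hH₂ : IsLUB (hessSet Φ₂ Λ₂) H₂)
    (hH₁0 : 0 < H₁) (hH₂0 : 0 < H₂)
    -- (i) convex hulls of the intersection surfaces stay inside the domains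
    (hconv : ∀ (a : ℝ) (h : Euc n),
      convexHull ℝ (SigmaSet Φ₁ Φ₂ Λ₁ Λ₂ a h) ⊆ Λ₁ ∩ {ξ | h - ξ ∈ Λ₂})
    -- (ii) small variation of the gradients
    (hsmall : ∀ ξ ∈ Λ₁, ∀ ξ' ∈ Λ₁, ∀ η ∈ Λ₂, ∀ η' ∈ Λ₂,
      ‖gradient Φ₁ ξ - gradient Φ₁ ξ'‖ + ‖gradient Φ₂ η - gradient Φ₂ η'‖ ≤ C₁ * C₂ / 2 * V)
    -- (iii) curvature
    (hcurv₁ : ∀ (a : ℝ) (h : Euc n), ∀ ξ ∈ SigmaSet Φ₁ Φ₂ Λ₁ Λ₂ a h,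
      ∀ ξ' ∈ SigmaSet Φ₁ Φ₂ Λ₁ Λ₂ a h,
        C₁ * H₁ * ‖ξ - ξ'‖ ^ 2 ≤ |⟪gradient Φ₁ ξ - gradient Φ₁ ξ', ξ - ξ'⟫|)
    (hcurv₂ : ∀ (a : ℝ) (h : Euc n), ∀ ξ ∈ SigmaSet Φ₂ Φ₁ Λ₂ Λ₁ a h,
      ∀ ξ' ∈ SigmaSet Φ₂ Φ₁ Λ₂ Λ₁ a h,
        C₁ * H₂ * ‖ξ - ξ'‖ ^ 2 ≤ |⟪gradient Φ₂ ξ - gradient Φ₂ ξ', ξ - ξ'⟫|)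
    -- (iv) transversality
    (htrans : ∀ ξ ∈ Λ₁, ∀ η ∈ Λ₂, C₂ * V ≤ ‖gradient Φ₁ ξ - gradient Φ₂ η‖) :
    (∀ (a : ℝ) (h : Euc n), ∀ ξ ∈ SigmaSet Φ₁ Φ₂ Λ₁ Λ₂ a h,
      ∀ ξ' ∈ SigmaSet Φ₁ Φ₂ Λ₁ Λ₂ a h, ∀ η ∈ Λ₂,
        C₁ * C₂ / 2 * V * H₁ * ‖ξ - ξ'‖ ≤
          wedge (gradient Φ₁ ξ - gradient Φ₁ ξ') (gradient Φ₁ ξ - gradient Φ₂ η)) ∧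
    (∀ (a : ℝ) (h : Euc n), ∀ ξ ∈ SigmaSet Φ₂ Φ₁ Λ₂ Λ₁ a h,
      ∀ ξ' ∈ SigmaSet Φ₂ Φ₁ Λ₂ Λ₁ a h, ∀ η ∈ Λ₁,
        C₁ * C₂ / 2 * V * H₂ * ‖ξ - ξ'‖ ≤
          wedge (gradient Φ₂ ξ - gradient Φ₂ ξ') (gradient Φ₂ ξ - gradient Φ₁ η)) := by
  have hswap : ∀ {a : ℝ} {h ξ : Euc n}, ξ ∈ SigmaSet Φ₂ Φ₁ Λ₂ Λ₁ a h →
      h - ξ ∈ SigmaSet Φ₁ Φ₂ Λ₁ Λ₂ a h := fun {a h ξ} hξ =>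
    ⟨hξ.2.1, by simpa using hξ.1, by simpa [add_comm] using hξ.2.2⟩
  refine ⟨fun a h ξ hξ ξ' hξ' η hη => ?_, fun a h ξ hξ ξ' hξ' η hη => ?_⟩
  · exact le_wedge_gradient_sub_gradient hC₁ hH₁0 hΛ₁ hΛ₂ hΦ₁ hΦ₂ hH₁.1 hsmall htrans
      ((segment_subset_convexHull hξ hξ').trans (hconv a h)) (hξ.2.2.trans hξ'.2.2.symm)
      (hcurv₁ a h ξ hξ ξ' hξ') hη
  · refine le_wedge_gradient_sub_gradient hC₁ hH₂0 hΛ₂ hΛ₁ hΦ₂ hΦ₁ hH₂.1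
      (fun x hx x' hx' y hy y' hy' => ?_) (fun x hx y hy => ?_) (h := h) (fun ζ hζ => ?_)
      (hξ.2.2.trans hξ'.2.2.symm) (hcurv₂ a h ξ hξ ξ' hξ') hη
    · rw [add_comm]
      exact hsmall y hy y' hy' x hx x' hx'
    · rw [norm_sub_rev]
      exact htrans y hy x hx
    · have hζ' : h - ζ ∈ segment ℝ (h - ξ) (h - ξ') := by
        obtain ⟨s, t, hs, ht, hst, rfl⟩ := hζ
        refine ⟨s, t, hs, ht, hst, ?_⟩
        rw [smul_sub, smul_sub, sub_add_sub_comm, ← add_smul, hst, one_smul]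
      have hmem := hconv a h (segment_subset_convexHull (hswap hξ) (hswap hξ') hζ')
      exact ⟨by simpa using hmem.2, hmem.1⟩
end

section
/- Let n ≥ 1 and 0 < C₀ < 1. Let Λ₁, Λ₂ ⊆ ℝⁿ be open and Φⱼ ∈ C²(Λⱼ) (j = 1,2) with sup_{Λ₁}|∇Φ₁| ≤ 3, sup_{Λ₂}|∇Φ₂| ≤ 3, and |∇Φ₁(ξ) − ∇Φ₂(η)| ≥ C₀ for all ξ ∈ Λ₁ and η ∈ Λ₂. Let 𝔥 = (a,h) ∈ ℝ^{1+n}, r > 0, and suppose ξ ∈ Λ₁ and η ∈ Λ₂ satisfy ξ + 5/(C₀ r) ⊆ Λ₁, η + 5/(C₀ r) ⊆ Λ₂, |ξ + η − h| ≤ 1/r and |Φ₁(ξ) + Φ₂(η) − a| ≤ 1/r. Then there exist ξ* ∈ Σ₁(𝔥) with |ξ − ξ*| ≤ 5/(C₀ r) and η* ∈ Σ₂(𝔥) with |η − η*| ≤ 5/(C₀ r). -/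
open MeasureTheory Metric Set
open scoped ENNReal RealInnerProductSpace NNReal

/-- If `F z ≥ F y - c ‖z - y‖` near `y`, then the gradient of `F` at `y` has norm at most `c`. -/
theorem HasGradientAt.norm_le_of_eventually_sub_le {E : Type*} [NormedAddCommGroup E]
    [InnerProductSpace ℝ E] [CompleteSpace E] {F : E → ℝ} {g y : E} {c : ℝ}
    (hF : HasGradientAt F g y) (hc : 0 ≤ c)
    (hmin : ∀ᶠ z in nhds y, F y - c * ‖z - y‖ ≤ F z) : ‖g‖ ≤ c := by
  rcases eq_or_ne g 0 with rfl | hg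
  · simpa using hc
  have hg' : 0 < ‖g‖ := norm_pos_iff.2 hg
  refine le_of_forall_pos_le_add fun ε hε => ?_
  have hsmall := (hasFDerivAt_iff_isLittleO.1 hF.hasFDerivAt).def hε
  have hlim : Filter.Tendsto (fun t : ℝ => y - t • g) (nhdsWithin 0 (Ioi 0)) (nhds y) := by
    have hcont : Continuous fun t : ℝ => y - t • g := by fun_prop
    simpa using (hcont.tendsto 0).mono_left nhdsWithin_le_nhds
  obtain ⟨t, ⟨hmin_t, hsmall_t⟩, ht⟩ :=
    ((hlim.eventually (hmin.and hsmall)).and self_mem_nhdsWithin).exists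
  have ht : 0 < t := ht
  have hdiff : y - t • g - y = -(t • g) := by abel
  rw [hdiff, norm_neg, norm_smul, Real.norm_of_nonneg ht.le] at hmin_t hsmall_t
  simp only [InnerProductSpace.toDual_apply_apply, inner_neg_right, inner_smul_right,
    real_inner_self_eq_norm_sq, Real.norm_eq_abs] at hsmall_t
  have hupper := (abs_le.1 hsmall_t).2
  have key : t * ‖g‖ * ‖g‖ ≤ t * ‖g‖ * (c + ε) := by nlinarith
  exact le_of_mul_le_mul_left key (by positivity)

/-- A function whose gradient has norm at least `C` on a ball of radius `R` around `x` takes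
there every value at distance less than `C * R` from `F x`. -/
theorem exists_mem_ball_eq_of_le_norm_gradient {E : Type*} [NormedAddCommGroup E]
    [InnerProductSpace ℝ E] [CompleteSpace E] [ProperSpace E] {F : E → ℝ} {x : E} {a C R : ℝ}
    (hC : 0 < C) (hF : ∀ y ∈ ball x R, ∃ g, HasGradientAt F g y ∧ C ≤ ‖g‖)
    (ha : |F x - a| < C * R) : ∃ y ∈ ball x R, F y = a := by
  have hR : |F x - a| / C < R := by rwa [div_lt_iff₀' hC]
  obtain ⟨ρ, hρ, hρR⟩ := exists_between hR
  have hρ0 : 0 < ρ := lt_of_le_of_lt (by positivity) hρ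
  have hρC : |F x - a| / ρ < C := by
    rw [div_lt_iff₀ hC] at hρ
    rwa [div_lt_iff₀' hρ0]
  obtain ⟨c, hc, hcC⟩ := exists_between hρC
  have hc0 : 0 < c := lt_of_le_of_lt (by positivity) hc
  rw [div_lt_iff₀ hρ0] at hc
  have hsub : closedBall x ρ ⊆ ball x R := closedBall_subset_ball hρR
  have hFcont : ContinuousOn F (closedBall x ρ) := fun y hy => by
    obtain ⟨g, hg, -⟩ := hF y (hsub hy)
    exact hg.continuousAt.continuousWithinAt
  have hGcont : ContinuousOn (fun y => |F y - a| + c * ‖y - x‖) (closedBall x ρ) := by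
    fun_prop
  obtain ⟨y, hy, hymin⟩ := (isCompact_closedBall x ρ).exists_isMinOn
    ⟨x, mem_closedBall_self hρ0.le⟩ hGcont
  have hyx : |F y - a| + c * ‖y - x‖ ≤ |F x - a| := by
    simpa using hymin (mem_closedBall_self hρ0.le)
  have hyρ : y ∈ ball x ρ := by
    rw [mem_ball_iff_norm]
    have := abs_nonneg (F y - a)
    exact lt_of_mul_lt_mul_left (by linarith) hc0.le
  refine ⟨y, hsub hy, ?_⟩
  obtain ⟨g, hg, hCg⟩ := hF y (hsub hy)
  have hloc : ∀ᶠ z in nhds y, |F y - a| - c * ‖z - y‖ ≤ |F z - a| := by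
    filter_upwards [isOpen_ball.mem_nhds hyρ] with z hz
    have hmin : |F y - a| + c * ‖y - x‖ ≤ |F z - a| + c * ‖z - x‖ :=
      hymin (ball_subset_closedBall hz)
    have htri : ‖z - x‖ ≤ ‖z - y‖ + ‖y - x‖ := norm_sub_le_norm_sub_add_norm_sub z y x
    nlinarith
  by_contra hne
  refine absurd hCg (not_le.2 (lt_of_le_of_lt ?_ hcC))
  rcases lt_or_gt_of_ne hne with hlt | hgt
  · have hneg : HasGradientAt (fun z => -F z) (-g) y := by
      rw [hasGradientAt_iff_hasFDerivAt, map_neg]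
      exact hg.hasFDerivAt.fun_neg
    rw [← norm_neg]
    refine hneg.norm_le_of_eventually_sub_le hc0.le ?_
    filter_upwards [hloc, hg.continuousAt.eventually_lt continuousAt_const hlt] with z hz hza
    rw [abs_of_neg (sub_neg.2 hlt), abs_of_neg (sub_neg.2 hza)] at hz
    linarith
  · refine hg.norm_le_of_eventually_sub_le hc0.le ?_
    filter_upwards [hloc, continuousAt_const.eventually_lt hg.continuousAt hgt] with z hz hza
    rw [abs_of_pos (sub_pos.2 hgt), abs_of_pos (sub_pos.2 hza)] at hz
    linarith

/-- One half of the foliation property: a point of `SigmaSet Φ₁ Φ₂ Λ₁ Λ₂ a h` near `ξ`. -/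
theorem exists_mem_SigmaSet_norm_sub_le {n : ℕ} {C₀ : ℝ} (hC₀0 : 0 < C₀) (hC₀1 : C₀ < 1)
    {Λ₁ Λ₂ : Set (Euc n)} {Φ₁ Φ₂ : Euc n → ℝ}
    (hΦ₁ : ∀ ξ ∈ Λ₁, DifferentiableAt ℝ Φ₁ ξ) (hΦ₂ : ∀ η ∈ Λ₂, DifferentiableAt ℝ Φ₂ η)
    (hg₂ : ∀ η ∈ Λ₂, ‖gradient Φ₂ η‖ ≤ 3)
    (htrans : ∀ ξ ∈ Λ₁, ∀ η ∈ Λ₂, C₀ ≤ ‖gradient Φ₁ ξ - gradient Φ₂ η‖)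
    {a : ℝ} {h : Euc n} {r : ℝ} (hr : 0 < r) {ξ η : Euc n}
    (hξ : ball ξ (5 / (C₀ * r)) ⊆ Λ₁) (hη : ball η (5 / (C₀ * r)) ⊆ Λ₂)
    (hsum : ‖ξ + η - h‖ ≤ 1 / r) (hval : |Φ₁ ξ + Φ₂ η - a| ≤ 1 / r) :
    ∃ ξ' ∈ SigmaSet Φ₁ Φ₂ Λ₁ Λ₂ a h, ‖ξ - ξ'‖ ≤ 5 / (C₀ * r) := by
  have hrinv : 0 < 1 / r := by positivity
  have hscale : C₀ * (5 / (C₀ * r)) = 5 * (1 / r) := by field_simp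
  have hlarge : 5 * (1 / r) < 5 / (C₀ * r) := by
    rw [← hscale]
    exact mul_lt_of_lt_one_left (by positivity) hC₀1
  have hball₁ : ball ξ (5 / (C₀ * r) - 1 / r) ⊆ ball ξ (5 / (C₀ * r)) :=
    ball_subset_ball (by linarith)
  have hball₂ : ∀ ζ ∈ ball ξ (5 / (C₀ * r) - 1 / r), h - ζ ∈ ball η (5 / (C₀ * r)) := by
    intro ζ hζ
    rw [mem_ball_iff_norm'] at hζ ⊢
    calc ‖η - (h - ζ)‖ = ‖(ξ + η - h) - (ξ - ζ)‖ := by congr 1; abel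
      _ ≤ ‖ξ + η - h‖ + ‖ξ - ζ‖ := norm_sub_le _ _
      _ < 5 / (C₀ * r) := by linarith
  have hξη : h - ξ ∈ ball η (5 / (C₀ * r)) := hball₂ ξ (mem_ball_self (by linarith))
  have hlip : |Φ₂ (h - ξ) - Φ₂ η| ≤ 3 * ‖h - ξ - η‖ := by
    refine (convex_ball η (5 / (C₀ * r))).norm_image_sub_le_of_norm_fderiv_le
      (𝕜 := ℝ) (fun z hz => hΦ₂ z (hη hz)) (fun z hz => ?_)
      (mem_ball_self (by linarith)) hξη
    rw [(hΦ₂ z (hη hz)).hasGradientAt.hasFDerivAt.fderiv, LinearIsometryEquiv.norm_map]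
    exact hg₂ z (hη hz)
  have hshift : ‖h - ξ - η‖ ≤ 1 / r := by
    rwa [← norm_neg, show -(h - ξ - η) = ξ + η - h by abel]
  have hinit : |Φ₁ ξ + Φ₂ (h - ξ) - a| < C₀ * (5 / (C₀ * r) - 1 / r) := by
    have htri : |Φ₁ ξ + Φ₂ (h - ξ) - a| ≤
        |Φ₁ ξ + Φ₂ η - a| + |Φ₂ (h - ξ) - Φ₂ η| := by
      rw [show Φ₁ ξ + Φ₂ (h - ξ) - a = Φ₁ ξ + Φ₂ η - a + (Φ₂ (h - ξ) - Φ₂ η) by ring]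
      exact abs_add_le _ _
    have : C₀ * (1 / r) < 1 / r := mul_lt_of_lt_one_left hrinv hC₀1
    rw [mul_sub, hscale]
    linarith
  have hgrad : ∀ ζ ∈ ball ξ (5 / (C₀ * r) - 1 / r),
      ∃ g, HasGradientAt (fun ζ => Φ₁ ζ + Φ₂ (h - ζ)) g ζ ∧ C₀ ≤ ‖g‖ := by
    intro ζ hζ
    have h₁ := hξ (hball₁ hζ)
    have h₂ := hη (hball₂ ζ hζ)
    refine ⟨gradient Φ₁ ζ - gradient Φ₂ (h - ζ), ?_, htrans _ h₁ _ h₂⟩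
    have hcomp := (hΦ₂ _ h₂).hasGradientAt.hasFDerivAt.comp ζ ((hasFDerivAt_id ζ).const_sub h)
    rw [hasGradientAt_iff_hasFDerivAt]
    refine ((hΦ₁ _ h₁).hasGradientAt.hasFDerivAt.add hcomp).congr_fderiv ?_
    ext v
    simp [sub_eq_add_neg]
  obtain ⟨ζ, hζ, hζa⟩ := exists_mem_ball_eq_of_le_norm_gradient
    (F := fun ζ => Φ₁ ζ + Φ₂ (h - ζ)) hC₀0 hgrad hinit
  exact ⟨ζ, ⟨hξ (hball₁ hζ), hη (hball₂ ζ hζ), hζa⟩, (mem_ball_iff_norm'.1 (hball₁ hζ)).le⟩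

/-- Lemma 6.1 (foliation properties of the surfaces `Σⱼ(𝔥)`). -/
theorem foliation_SigmaSet (n : ℕ) (hn : 1 ≤ n) (C₀ : ℝ) (hC₀0 : 0 < C₀) (hC₀1 : C₀ < 1)
    (Λ₁ Λ₂ : Set (Euc n)) (Φ₁ Φ₂ : Euc n → ℝ)
    (hΛ₁ : IsOpen Λ₁) (hΛ₂ : IsOpen Λ₂)
    (hΦ₁ : ContDiffOn ℝ 2 Φ₁ Λ₁) (hΦ₂ : ContDiffOn ℝ 2 Φ₂ Λ₂)
    (hg₁ : ∀ ξ ∈ Λ₁, ‖gradient Φ₁ ξ‖ ≤ 3) (hg₂ : ∀ η ∈ Λ₂, ‖gradient Φ₂ η‖ ≤ 3)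
    (htrans : ∀ ξ ∈ Λ₁, ∀ η ∈ Λ₂, C₀ ≤ ‖gradient Φ₁ ξ - gradient Φ₂ η‖)
    (a : ℝ) (h : Euc n) (r : ℝ) (hr : 0 < r) (ξ : Euc n) (η : Euc n)
    (hξ : Metric.ball ξ (5 / (C₀ * r)) ⊆ Λ₁) (hη : Metric.ball η (5 / (C₀ * r)) ⊆ Λ₂)
    (hsum : ‖ξ + η - h‖ ≤ 1 / r) (hval : |Φ₁ ξ + Φ₂ η - a| ≤ 1 / r) :
    (∃ ξ' ∈ SigmaSet Φ₁ Φ₂ Λ₁ Λ₂ a h, ‖ξ - ξ'‖ ≤ 5 / (C₀ * r)) ∧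
    (∃ η' ∈ SigmaSet Φ₂ Φ₁ Λ₂ Λ₁ a h, ‖η - η'‖ ≤ 5 / (C₀ * r)) := by
  have hd₁ : ∀ ξ ∈ Λ₁, DifferentiableAt ℝ Φ₁ ξ := fun ξ hξ =>
    (hΦ₁.differentiableOn (by norm_num)).differentiableAt (hΛ₁.mem_nhds hξ)
  have hd₂ : ∀ η ∈ Λ₂, DifferentiableAt ℝ Φ₂ η := fun η hη =>
    (hΦ₂.differentiableOn (by norm_num)).differentiableAt (hΛ₂.mem_nhds hη)
  refine ⟨exists_mem_SigmaSet_norm_sub_le hC₀0 hC₀1 hd₁ hd₂ hg₂ htrans hr hξ hη hsum hval,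
    exists_mem_SigmaSet_norm_sub_le hC₀0 hC₀1 hd₂ hd₁ hg₁
      (fun η hη ξ hξ => ?_) hr hη hξ ?_ ?_⟩
  · rw [norm_sub_rev]
    exact htrans ξ hξ η hη
  · rwa [add_comm η ξ]
  · rwa [add_comm (Φ₂ η) (Φ₁ ξ)]
end

section
/- Let n ≥ 2 and 0 < C₀ ≤ 1. Let Λ₁, Λ₂ ⊆ ℝⁿ be open and Φⱼ ∈ C¹(Λⱼ) (j = 1,2) with 𝒱 = 1, 0 < ℋⱼ < ∞, sup_{Λⱼ}|∇Φⱼ| ≤ 3, satisfying hypothesis (A1) with constant C₀ and the transversality bound |∇Φ₁(ξ) − ∇Φ₂(η)| ≥ C₀ for all ξ ∈ Λ₁, η ∈ Λ₂. Let 𝔥 ∈ ℝ^{1+n} and {j,k} = {1,2}, and define the cone 𝒞ⱼ(𝔥) := {(s, −s∇Φⱼ(ξ)) ∈ ℝ^{1+n} : s ∈ ℝ, ξ ∈ Σⱼ(𝔥)}. Then for all p, q ∈ 𝒞ⱼ(𝔥) and all η ∈ Λₖ, |(p − q) ∧ (1, −∇Φₖ(η))| ≥ (C₀²/4) |p − q|.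 -/
open MeasureTheory Metric Set
open scoped ENNReal RealInnerProductSpace NNReal

/-- The Euclidean norm on space-time `ℝ^{1+n} = ℝ × ℝⁿ`. -/
noncomputable def snorm2 {n : ℕ} (p : ℝ × Euc n) : ℝ :=
  Real.sqrt (p.1 ^ 2 + ‖p.2‖ ^ 2)

/-- The Euclidean inner product on space-time `ℝ^{1+n} = ℝ × ℝⁿ`. -/
noncomputable def sinner {n : ℕ} (p q : ℝ × Euc n) : ℝ :=
  p.1 * q.1 + ⟪p.2, q.2⟫

/-- The wedge `|p ∧ q|` on space-time `ℝ^{1+n} = ℝ × ℝⁿ`. -/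
noncomputable def swedge {n : ℕ} (p q : ℝ × Euc n) : ℝ :=
  Real.sqrt (snorm2 p ^ 2 * snorm2 q ^ 2 - sinner p q ^ 2)

/-- The conic hypersurface `𝒞ⱼ(𝔥)` (with `Φj, Λj` in the first slots). -/
def coneSet {n : ℕ} (Φj Φk : Euc n → ℝ) (Λj Λk : Set (Euc n)) (a : ℝ) (h : Euc n) :
    Set (ℝ × Euc n) :=
  {p | ∃ s : ℝ, ∃ ξ ∈ SigmaSet Φj Φk Λj Λk a h, p = (s, -s • gradient Φj ξ)}

/-- A planar quadratic-form inequality: if `W² ≥ c²S² + (T - βS)²`, then both elementary bounds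
`W + 3S` and `3S + T` for `X` together give `c²(S² + X²) ≤ 16 W²`. -/
lemma sq_mul_add_le_of_quadratic {c β S T W X : ℝ} (hc0 : 0 ≤ c)
    (hβ0 : 0 ≤ β) (hβ : c ^ 2 + β ^ 2 ≤ 1) (hS : 0 ≤ S) (hW0 : 0 ≤ W)
    (hX0 : 0 ≤ X) (hW : c ^ 2 * S ^ 2 + (T - β * S) ^ 2 ≤ W ^ 2)
    (hX₁ : X ≤ W + 3 * S) (hX₂ : X ≤ 3 * S + T) :
    c ^ 2 * (S ^ 2 + X ^ 2) ≤ 16 * W ^ 2 := by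
  rcases le_total c (87 / 100) with hc | hc
  · have hcS : c * S ≤ W := abs_le_of_sq_le_sq' (by nlinarith [sq_nonneg (T - β * S)]) hW0 |>.2
    have hcX : c * X ≤ (387 / 100) * W := by nlinarith
    have h₁ : (c * S) ^ 2 ≤ W ^ 2 := pow_le_pow_left₀ (by positivity) hcS 2
    have h₂ : (c * X) ^ 2 ≤ ((387 / 100) * W) ^ 2 := pow_le_pow_left₀ (by positivity) hcX 2
    nlinarith [sq_nonneg W]
  · have hβ' : β ≤ 1 / 2 := by nlinarith
    set z := T - β * S with hz
    have hXz : X ≤ (7 / 2) * S + |z| := by nlinarith [le_abs_self z]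
    have h₁ : X ^ 2 ≤ ((7 / 2) * S + |z|) ^ 2 := pow_le_pow_left₀ hX0 hXz 2
    have h₂ : c ^ 2 * X ^ 2 ≤ c ^ 2 * ((7 / 2) * S + |z|) ^ 2 :=
      mul_le_mul_of_nonneg_left h₁ (sq_nonneg c)
    have hc2 : c ^ 2 ≤ 1 := by nlinarith
    have h₃ : c ^ 2 * |z| ^ 2 ≤ |z| ^ 2 := mul_le_of_le_one_left (sq_nonneg _) hc2
    have h₄ : 0 ≤ c ^ 2 * ((11 / 4) * S ^ 2 - 7 * S * |z| + 5 * |z| ^ 2) :=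
      mul_nonneg (sq_nonneg c) (by nlinarith [sq_nonneg (S - (14 / 11) * |z|)])
    rw [← sq_abs z] at hW
    nlinarith

/-- If the wedge of `d` and `a` is at least `c ‖d‖`, the component of `a` along `d` has size `β`
with `c² + β² ≤ ‖a‖²`. -/
lemma exists_component_bound {n : ℕ} {c : ℝ} (hc0 : 0 ≤ c) {a d : Euc n} (hca : c ≤ ‖a‖)
    (hw : c * ‖d‖ ≤ wedge d a) :
    ∃ β : ℝ, 0 ≤ β ∧ |⟪a, d⟫| = β * ‖d‖ ∧ c ^ 2 + β ^ 2 ≤ ‖a‖ ^ 2 := by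
  rcases eq_or_ne d 0 with rfl | hd
  · exact ⟨0, le_rfl, by simp, by nlinarith⟩
  · have hd' : 0 < ‖d‖ := norm_pos_iff.mpr hd
    have hβ : |⟪a, d⟫| = |⟪a, d⟫| / ‖d‖ * ‖d‖ := by field_simp
    refine ⟨|⟪a, d⟫| / ‖d‖, by positivity, hβ, ?_⟩
    set β := |⟪a, d⟫| / ‖d‖
    have hsq : ⟪d, a⟫ ^ 2 = β ^ 2 * ‖d‖ ^ 2 := by
      rw [real_inner_comm, ← sq_abs, hβ]; ring
    have hnn : 0 ≤ ‖d‖ ^ 2 * ‖a‖ ^ 2 - ⟪d, a⟫ ^ 2 := by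
      have := pow_le_pow_left₀ (abs_nonneg _) (abs_real_inner_le_norm d a) 2
      rw [sq_abs] at this
      nlinarith
    have h := pow_le_pow_left₀ (by positivity) hw 2
    rw [wedge, Real.sq_sqrt hnn, hsq] at h
    have hd2 : 0 < ‖d‖ ^ 2 := by positivity
    refine le_of_mul_le_mul_right ?_ hd2
    nlinarith

/-- The difference of two points of the cone over `{u, v}`, measured against the shear by `w`. -/
lemma sq_mul_add_norm_sq_le {n : ℕ} {c : ℝ} (hc0 : 0 ≤ c) {u v w : Euc n}
    (hu : ‖u‖ ≤ 3) (hw : ‖w‖ ≤ 3) (hca : c ≤ ‖u - w‖) (ha : ‖u - w‖ ≤ 1)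
    (hwedge : c * ‖u - v‖ ≤ wedge (u - v) (u - w)) (s t : ℝ) :
    c ^ 2 * ((s - t) ^ 2 + ‖s • u - t • v‖ ^ 2) ≤
      16 * ‖s • u - t • v - (s - t) • w‖ ^ 2 := by
  obtain ⟨β, hβ0, hβ, hcβ⟩ := exists_component_bound hc0 hca hwedge
  have ha2 : ‖u - w‖ ^ 2 ≤ 1 := by nlinarith [norm_nonneg (u - w)]
  rw [← sq_abs (s - t)]
  have hY : s • u - t • v - (s - t) • w = (s - t) • (u - w) + t • (u - v) := by module
  refine sq_mul_add_le_of_quadratic (β := β) (T := |t| * ‖u - v‖) hc0 hβ0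
    (hcβ.trans ha2) (abs_nonneg _) (norm_nonneg _) (norm_nonneg _) ?_ ?_ ?_
  · rw [hY, norm_add_sq_real, norm_smul, norm_smul, inner_smul_left, inner_smul_right,
      Real.norm_eq_abs, Real.norm_eq_abs]
    have h₁ : -(|s - t| * (|t| * (β * ‖u - v‖))) ≤ (s - t) * (t * ⟪u - w, u - v⟫) := by
      rw [← hβ, ← abs_mul, ← abs_mul]
      exact neg_abs_le _
    have h₂ := mul_le_mul_of_nonneg_right hcβ (sq_nonneg |s - t|)
    simp only [conj_trivial]
    nlinarith
  · calc ‖s • u - t • v‖ = ‖(s • u - t • v - (s - t) • w) + (s - t) • w‖ := by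
          rw [sub_add_cancel]
      _ ≤ ‖s • u - t • v - (s - t) • w‖ + |s - t| * ‖w‖ := by
          rw [← Real.norm_eq_abs, ← norm_smul]; exact norm_add_le _ _
      _ ≤ _ := by nlinarith [abs_nonneg (s - t)]
  · calc ‖s • u - t • v‖ = ‖(s - t) • u + t • (u - v)‖ := by congr 1; module
      _ ≤ |s - t| * ‖u‖ + |t| * ‖u - v‖ := by
          rw [← Real.norm_eq_abs, ← Real.norm_eq_abs, ← norm_smul, ← norm_smul]
          exact norm_add_le _ _
      _ ≤ _ := by nlinarith [abs_nonneg (s - t)]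

lemma norm_sub_smul_le_swedge {n : ℕ} (r : ℝ) (x w : Euc n) :
    ‖x - r • w‖ ≤ swedge (r, -x) (1, -w) := by
  have hp (p : ℝ × Euc n) : snorm2 p ^ 2 = p.1 ^ 2 + ‖p.2‖ ^ 2 :=
    Real.sq_sqrt (by positivity)
  refine Real.le_sqrt_of_sq_le ?_
  rw [hp, hp, sinner, norm_sub_sq_real, norm_smul, inner_smul_right, mul_pow, Real.norm_eq_abs,
    sq_abs]
  have h := pow_le_pow_left₀ (abs_nonneg _) (abs_real_inner_le_norm x w) 2
  rw [sq_abs] at h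
  simp only [norm_neg, inner_neg_neg]
  nlinarith

/-- Transversality of the cone for one ordered pair of phases. -/
lemma coneSet_transversal {n : ℕ} {C₀ : ℝ} (hC₀0 : 0 < C₀) (hC₀1 : C₀ ≤ 1)
    {Λj Λk : Set (Euc n)} {Φj Φk : Euc n → ℝ} {H : ℝ}
    (hgj : ∀ ξ ∈ Λj, ‖gradient Φj ξ‖ ≤ 3) (hgk : ∀ η ∈ Λk, ‖gradient Φk η‖ ≤ 3)
    (hA1 : A1pair Φj Φk Λj Λk H 1 C₀)
    (hV : ∀ ξ ∈ Λj, ∀ η ∈ Λk, ‖gradient Φj ξ - gradient Φk η‖ ≤ 1)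
    (htrans : ∀ ξ ∈ Λj, ∀ η ∈ Λk, C₀ ≤ ‖gradient Φj ξ - gradient Φk η‖)
    (a : ℝ) (h : Euc n) {p q : ℝ × Euc n} (hp : p ∈ coneSet Φj Φk Λj Λk a h)
    (hq : q ∈ coneSet Φj Φk Λj Λk a h) {η : Euc n} (hη : η ∈ Λk) :
    C₀ ^ 2 / 4 * snorm2 (p - q) ≤ swedge (p - q) (1, -gradient Φk η) := by
  obtain ⟨s, ξ, hξ, rfl⟩ := hp
  obtain ⟨t, ξ', hξ', rfl⟩ := hq
  obtain ⟨h₁, h₂⟩ := hA1 a h ξ hξ ξ' hξ' η hη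
  have hC := htrans ξ hξ.1 η hη
  have key := sq_mul_add_norm_sq_le (c := C₀ ^ 2) (by positivity) (hgj ξ hξ.1) (hgk η hη)
    (by nlinarith) (hV ξ hξ.1 η hη) (by nlinarith) s t (v := gradient Φj ξ')
  have hpq : ((s, -s • gradient Φj ξ) : ℝ × Euc n) - (t, -t • gradient Φj ξ') =
      (s - t, -(s • gradient Φj ξ - t • gradient Φj ξ')) :=
    Prod.ext rfl (by simp only [Prod.snd_sub]; module)
  rw [hpq]
  refine le_trans ?_ (norm_sub_smul_le_swedge _ _ _)
  refine abs_le_of_sq_le_sq' ?_ (norm_nonneg _) |>.2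
  rw [mul_pow, snorm2, Real.sq_sqrt (by positivity), norm_neg]
  nlinarith

/-- Lemma 6.2 (transversality of the cone `𝒞ⱼ(𝔥)`). -/
theorem cone_transversal (n : ℕ) (hn : 2 ≤ n) (C₀ : ℝ) (hC₀0 : 0 < C₀) (hC₀1 : C₀ ≤ 1)
    (Λ₁ Λ₂ : Set (Euc n)) (Φ₁ Φ₂ : Euc n → ℝ) (H₁ H₂ : ℝ)
    (hΛ₁ : IsOpen Λ₁) (hΛ₂ : IsOpen Λ₂)
    (hΦ₁ : ContDiffOn ℝ 1 Φ₁ Λ₁) (hΦ₂ : ContDiffOn ℝ 1 Φ₂ Λ₂)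
    (hV : IsLUB (gradDiffSet Φ₁ Φ₂ Λ₁ Λ₂) 1)
    (hH₁ : IsLUB (hessSet Φ₁ Λ₁) H₁) (hH₂ : IsLUB (hessSet Φ₂ Λ₂) H₂)
    (hH₁0 : 0 < H₁) (hH₂0 : 0 < H₂)
    (hg₁ : ∀ ξ ∈ Λ₁, ‖gradient Φ₁ ξ‖ ≤ 3) (hg₂ : ∀ η ∈ Λ₂, ‖gradient Φ₂ η‖ ≤ 3)
    (hA1 : A1 Φ₁ Φ₂ Λ₁ Λ₂ H₁ H₂ 1 C₀)
    (htrans : ∀ ξ ∈ Λ₁, ∀ η ∈ Λ₂, C₀ ≤ ‖gradient Φ₁ ξ - gradient Φ₂ η‖) :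
    (∀ (a : ℝ) (h : Euc n), ∀ p ∈ coneSet Φ₁ Φ₂ Λ₁ Λ₂ a h,
      ∀ q ∈ coneSet Φ₁ Φ₂ Λ₁ Λ₂ a h, ∀ η ∈ Λ₂,
        C₀ ^ 2 / 4 * snorm2 (p - q) ≤ swedge (p - q) (1, -gradient Φ₂ η)) ∧
    (∀ (a : ℝ) (h : Euc n), ∀ p ∈ coneSet Φ₂ Φ₁ Λ₂ Λ₁ a h,
      ∀ q ∈ coneSet Φ₂ Φ₁ Λ₂ Λ₁ a h, ∀ η ∈ Λ₁,
        C₀ ^ 2 / 4 * snorm2 (p - q) ≤ swedge (p - q) (1, -gradient Φ₁ η)) := by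
  have hV' : ∀ ξ ∈ Λ₁, ∀ η ∈ Λ₂, ‖gradient Φ₁ ξ - gradient Φ₂ η‖ ≤ 1 :=
    fun ξ hξ η hη => hV.1 ⟨ξ, hξ, η, hη, rfl⟩
  refine ⟨fun a h p hp q hq η hη => ?_, fun a h p hp q hq η hη => ?_⟩
  · exact coneSet_transversal hC₀0 hC₀1 hg₁ hg₂ hA1.1 hV' htrans a h hp hq hη
  · exact coneSet_transversal hC₀0 hC₀1 hg₂ hg₁ hA1.2
      (fun ξ hξ η hη => norm_sub_rev (gradient Φ₁ η) _ ▸ hV' η hη ξ hξ)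
      (fun ξ hξ η hη => norm_sub_rev (gradient Φ₁ η) _ ▸ htrans η hη ξ hξ) a h hp hq hη
end

section
/- Let d ≥ 1, 1 ≤ q, r < ∞, R > 0, and let Q_R ⊆ ℝ^d be an axis-parallel cube of side length R. Let M ≥ 1 and let (ε_m)_{m=1}^M, (r_m)_{m=1}^M be positive reals with r_m ≤ 2R for each m and ε := Σ_{m=1}^M ε_m ≤ 2^{−(d+1)}. Then for every measurable F : ℝ^d → [0,∞] there exists an axis-parallel cube Q of side length 2R with Q_R ⊆ Q ⊆ 4Q_R (the concentric dilate of Q_R) such that ‖F‖_{L^q_t L^r_x(Q_R)} ≤ (1 + 2^{d+1} ε) ‖F‖_{L^q_t L^r_x(Q_R ∩ X[Q])}, where X[Q] := ∩_{m=1}^M I^{ε_m, r_m}(Q). -/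
open MeasureTheory Metric Set
open scoped ENNReal NNReal

noncomputable section

/-- Space-time `ℝ^d = ℝ × ℝ^{d-1}`. -/
abbrev SpTime (m : ℕ) := ℝ × (Fin m → ℝ)

/-- The axis-parallel cube with corner `c` and side length `R` (a translate of `[0,R)^d`). -/
def cube {m : ℕ} (c : SpTime m) (R : ℝ) : Set (SpTime m) :=
  {p | p.1 ∈ Set.Ico c.1 (c.1 + R) ∧ ∀ i, p.2 i ∈ Set.Ico (c.2 i) (c.2 i + R)}

/-- The dyadic scale `j₀` determined by `2^{-1-j₀} L < r ≤ 2^{-j₀} L`. -/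
def jscale (L r : ℝ) : ℕ := (Int.log 2 (L / r)).toNat

/-- `I^{ε,r}(Q)` for the cube `Q = cube c L`: the union of the `(1-ε)`-shrunk
(concentric) subcubes of the dyadic partition of `Q` at scale `r`. -/
def Iset {m : ℕ} (c : SpTime m) (L ε r : ℝ) : Set (SpTime m) :=
  ⋃ (v : Fin (2 ^ jscale L r) × (Fin m → Fin (2 ^ jscale L r))),
    cube (c.1 + ((v.1 : ℕ) : ℝ) * (L / 2 ^ jscale L r) + ε * (L / 2 ^ jscale L r) / 2,
        fun i => c.2 i + ((v.2 i : ℕ) : ℝ) * (L / 2 ^ jscale L r) +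
          ε * (L / 2 ^ jscale L r) / 2)
      ((1 - ε) * (L / 2 ^ jscale L r))

/-- The mixed norm `‖F‖_{L^q_t L^r_x(Ω)}` of a nonnegative `F`. -/
def mixedNormST {m : ℕ} (q r : ℝ) (Ω : Set (SpTime m)) (F : SpTime m → ℝ≥0∞) : ℝ≥0∞ :=
  (∫⁻ t : ℝ, (∫⁻ x : Fin m → ℝ, Ω.indicator (fun p => F p ^ r) (t, x)) ^ (q / r)) ^ (1 / q)

/-- The points of `[0, 2 ^ j * l)` lying in one of the shrunk subintervals of length
`(1 - ε) * l`: the one-dimensional version of `Iset`. -/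
def MemShrunkGrid (j : ℕ) (l ε u : ℝ) : Prop :=
  ∃ v : Fin (2 ^ j), (v : ℕ) * l + ε * l / 2 ≤ u ∧ u < (v : ℕ) * l + ε * l / 2 + (1 - ε) * l

theorem mem_Iset_iff {m : ℕ} {c p : SpTime m} {L ε r : ℝ} :
    p ∈ Iset c L ε r ↔
      MemShrunkGrid (jscale L r) (L / 2 ^ jscale L r) ε (p.1 - c.1) ∧
      ∀ i, MemShrunkGrid (jscale L r) (L / 2 ^ jscale L r) ε (p.2 i - c.2 i) := by
  simp only [Iset, cube, MemShrunkGrid, mem_iUnion, mem_ofPred_eq, mem_Ico, Prod.exists]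
  constructor
  · rintro ⟨v, w, ⟨h1, h2⟩, h3⟩
    refine ⟨⟨v, by linarith, by linarith⟩, fun i => ⟨w i, ?_, ?_⟩⟩
    · linarith [(h3 i).1]
    · linarith [(h3 i).2]
  · rintro ⟨⟨v, h1, h2⟩, h3⟩
    choose w hw using h3
    refine ⟨v, w, ⟨by linarith, by linarith⟩, fun i => ⟨?_, ?_⟩⟩
    · linarith [(hw i).1]
    · linarith [(hw i).2]

theorem lt_floor_add_of_not_memShrunkGrid {j : ℕ} {l ε u : ℝ} (hl : 0 < l) (hε : 0 < ε)
    (hu : u < 2 ^ j * l) (h : ¬ MemShrunkGrid j l ε u) :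
    u / l + ε / 2 < ⌊u / l + ε / 2⌋₊ + ε := by
  by_contra! hw
  have hlt := Nat.lt_floor_add_one (u / l + ε / 2)
  set v := ⌊u / l + ε / 2⌋₊
  have hul : u / l * l = u := div_mul_cancel₀ u hl.ne'
  have h1 : (v : ℝ) * l + ε * l / 2 ≤ u := by
    have := mul_le_mul_of_nonneg_right hw hl.le
    linarith
  have h2 : u < (v : ℝ) * l + ε * l / 2 + (1 - ε) * l := by
    have := mul_lt_mul_of_pos_right hlt hl
    linarith
  have hv : v < 2 ^ j := by
    have : (v : ℝ) * l < 2 ^ j * l := by nlinarith [mul_pos hε hl]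
    exact_mod_cast lt_of_mul_lt_mul_right this hl.le
  exact h ⟨⟨v, hv⟩, h1, h2⟩

theorem card_filter_mod_lt_le (s n T : ℕ) (B : ℝ) :
    ((Finset.range (n * T)).filter fun k => (((s + k) % n : ℕ) : ℝ) < B).card ≤ ⌈B⌉₊ * T := by
  rw [← Finset.card_range ⌈B⌉₊, ← Finset.card_range T, ← Finset.card_product,
    Finset.card_range T]
  refine Finset.card_le_card_of_injOn (fun k => ((s + k) % n, k / n)) ?_ ?_
  · intro k hk
    simp only [Finset.coe_filter, Finset.mem_range, mem_ofPred_eq] at hk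
    simp only [Finset.coe_product, Finset.coe_range, mem_prod, mem_Iio]
    exact ⟨Nat.lt_ceil.2 hk.2, Nat.div_lt_of_lt_mul hk.1⟩
  · intro k _ k' _ h
    simp only [Prod.mk.injEq] at h
    have h1 : k % n = k' % n := Nat.ModEq.add_left_cancel' s h.1
    rw [← Nat.div_add_mod k n, ← Nat.div_add_mod k' n, h1, h.2]

open Classical in
theorem card_not_memShrunkGrid_le {j J K : ℕ} (hj : j ≤ J) (hK : 0 < K) {R ε a : ℝ} (hR : 0 < R)
    (hε : 0 < ε) (hε' : ε ≤ 1 / 4) (ha : 0 ≤ a) (ha' : a < R) :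
    (((Finset.range (2 ^ J * K)).filter fun k : ℕ =>
      ¬ MemShrunkGrid j (2 * R / 2 ^ j) ε (a + k * (R / (2 ^ J * K : ℕ)))).card : ℝ) ≤
      ε * (2 ^ J * K : ℕ) + 2 ^ J := by
  have hJ : (1 : ℝ) ≤ 2 ^ J := one_le_pow₀ (by norm_num)
  have hN : 0 < 2 ^ J * K := by positivity
  have hub : ∀ k ∈ Finset.range (2 ^ J * K), (k : ℝ) * (R / (2 ^ J * K : ℕ)) < R := by
    intro k hk
    have hk' : (k : ℝ) < (2 ^ J * K : ℕ) := by exact_mod_cast Finset.mem_range.1 hk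
    rw [← mul_div_assoc, div_lt_iff₀ (by positivity), mul_comm]
    gcongr
  rcases j with _ | i
  · generalize 2 ^ J * K = N at *
    have hN' : (0 : ℝ) < N := by exact_mod_cast hN
    have key : ((Finset.range N).filter fun k : ℕ =>
        ¬ MemShrunkGrid 0 (2 * R / 2 ^ 0) ε (a + k * (R / N))).card ≤ ⌈ε * N⌉₊ := by
      have hbad : ∀ k : ℕ, ¬ MemShrunkGrid 0 (2 * R / 2 ^ 0) ε (a + k * (R / N)) →
          a + k * (R / N) < ε * R ∨ 2 * R - ε * R ≤ a + k * (R / N) := by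
        intro k hk
        by_contra! h
        exact hk ⟨0, by simp; linarith, by simp; linarith⟩
      have hεR : ε * R ≤ 1 / 4 * R := by gcongr
      rw [← Finset.card_range ⌈ε * N⌉₊]
      rcases lt_or_ge a (R / 2) with h | h
      · refine Finset.card_le_card fun k hk => ?_
        simp only [Finset.mem_filter] at hk
        have h1 := hub k hk.1
        have h2 : k * (R / N) < ε * R := by
          rcases hbad k hk.2 with h' | h' <;> linarith
        rw [Finset.mem_range, Nat.lt_ceil]
        rw [← mul_div_assoc, div_lt_iff₀ hN'] at h2
        nlinarith
      · refine Finset.card_le_card_of_injOn (fun k => N - 1 - k) ?_ ?_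
        · intro k hk
          simp only [Finset.coe_filter, mem_ofPred_eq] at hk
          have hkN := Finset.mem_range.1 hk.1
          have h0 : (0 : ℝ) ≤ k * (R / N) := by positivity
          have h2 : (1 - ε) * R < k * (R / N) := by
            rcases hbad k hk.2 with h' | h' <;> linarith
          simp only [Finset.coe_range, mem_Iio]
          rw [Nat.lt_ceil, Nat.sub_sub, Nat.cast_sub (by omega)]
          rw [← mul_div_assoc, lt_div_iff₀ hN'] at h2
          push_cast
          have : (1 - ε) * N < k := by
            refine lt_of_mul_lt_mul_right ?_ hR.le
            linarith
          linarith
        · intro k hk k' hk' h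
          simp only [Finset.coe_filter, Finset.mem_range, mem_ofPred_eq] at hk hk' h
          omega
    calc _ ≤ ((⌈ε * N⌉₊ : ℕ) : ℝ) := by exact_mod_cast key
      _ ≤ ε * N + 1 := (Nat.ceil_lt_add_one (by positivity)).le
      _ ≤ _ := by gcongr
  · obtain ⟨e, rfl⟩ : ∃ e, J = i + e := ⟨J - i, by omega⟩
    set n := 2 ^ e * K with hn
    have hn0 : 0 < n := by positivity
    have hn' : (0 : ℝ) < n := by exact_mod_cast hn0
    have hNn : 2 ^ (i + e) * K = n * 2 ^ i := by rw [hn]; ring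
    rw [hNn] at hub ⊢
    set l := 2 * R / 2 ^ (i + 1) with hl
    have hl0 : 0 < l := by positivity
    have hRl : R / (n * 2 ^ i : ℕ) = l / n := by
      rw [hl]; push_cast; field_simp; ring
    set s := ⌊n * (a / l + ε / 2)⌋₊ with hs
    have hsub : ((Finset.range (n * 2 ^ i)).filter fun k : ℕ =>
        ¬ MemShrunkGrid (i + 1) l ε (a + k * (R / (n * 2 ^ i : ℕ)))) ⊆
        (Finset.range (n * 2 ^ i)).filter fun k => (((s + k) % n : ℕ) : ℝ) < n * ε := by
      intro k hk
      rw [Finset.mem_filter] at hk ⊢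
      refine ⟨hk.1, ?_⟩
      have h1 := hub k hk.1
      have h2 : (2 : ℝ) ^ (i + 1) * l = 2 * R := by rw [hl]; field_simp
      have h3 := lt_floor_add_of_not_memShrunkGrid hl0 hε
        (by rw [h2]; linarith) hk.2
      rw [hRl] at h3
      set w := (a + k * (l / n)) / l + ε / 2 with hw
      have hnw : n * w = n * (a / l + ε / 2) + k := by
        rw [hw]; field_simp; ring
      have hfl : ⌊n * w⌋₊ = s + k := by
        rw [hnw, Nat.floor_add_natCast (by positivity)]
      have hfw : ⌊w⌋₊ = (s + k) / n := by
        rw [← hfl, ← Nat.floor_div_natCast, mul_div_cancel_left₀ _ hn'.ne']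
      have hle : ((s + k : ℕ) : ℝ) ≤ n * w := by
        rw [← hfl]; exact Nat.floor_le (by positivity)
      have hdm : ((s + k : ℕ) : ℝ) = n * ⌊w⌋₊ + ((s + k) % n : ℕ) := by
        rw [hfw]; exact_mod_cast (Nat.div_add_mod (s + k) n).symm
      have := mul_lt_mul_of_pos_left h3 hn'
      linarith
    calc _ ≤ ((⌈n * ε⌉₊ * 2 ^ i : ℕ) : ℝ) := by
          exact_mod_cast (Finset.card_le_card hsub).trans (card_filter_mod_lt_le _ _ _ _)
      _ ≤ (n * ε + 1) * 2 ^ i := by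
          push_cast
          gcongr
          exact (Nat.ceil_lt_add_one (by positivity)).le
      _ = ε * (n * 2 ^ i : ℕ) + 2 ^ i := by push_cast; ring
      _ ≤ _ := by
          gcongr
          · norm_num
          · omega

theorem measurableSet_cube {m : ℕ} (c : SpTime m) (R : ℝ) : MeasurableSet (cube c R) := by
  have : cube c R = Prod.fst ⁻¹' Ico c.1 (c.1 + R) ∩
      ⋂ i, (fun p : SpTime m => p.2 i) ⁻¹' Ico (c.2 i) (c.2 i + R) := by
    ext p; simp [cube]
  rw [this]
  exact (measurable_fst measurableSet_Ico).inter (MeasurableSet.iInter fun i =>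
    ((measurable_pi_apply i).comp measurable_snd) measurableSet_Ico)

theorem measurableSet_Iset {m : ℕ} (c : SpTime m) (L ε r : ℝ) : MeasurableSet (Iset c L ε r) :=
  MeasurableSet.iUnion fun _ => measurableSet_cube _ _

/-- The mixed norm of `G` over the whole space. -/
def mixedLp {m : ℕ} (q r : ℝ) (G : SpTime m → ℝ≥0∞) : ℝ≥0∞ :=
  (∫⁻ t : ℝ, ((∫⁻ x : Fin m → ℝ, G (t, x) ^ r) ^ (1 / r)) ^ q) ^ (1 / q)

theorem mixedNormST_eq_mixedLp {m : ℕ} {q r : ℝ} (hr : 0 < r) (Ω : Set (SpTime m))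
    (F : SpTime m → ℝ≥0∞) : mixedNormST q r Ω F = mixedLp q r (Ω.indicator F) := by
  have h : ∀ p, Ω.indicator (fun p => F p ^ r) p = Ω.indicator F p ^ r := by
    intro p
    by_cases hp : p ∈ Ω <;> simp [hp, hr]
  simp only [mixedNormST, mixedLp, h, ← ENNReal.rpow_mul, one_div_mul_eq_div]

theorem mixedLp_mono {m : ℕ} {q r : ℝ} (hq : 0 < q) (hr : 0 < r) {F G : SpTime m → ℝ≥0∞}
    (h : ∀ p, F p ≤ G p) : mixedLp q r F ≤ mixedLp q r G := by
  unfold mixedLp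
  gcongr
  exact h _

theorem mixedLp_const_mul {m : ℕ} {q r : ℝ} (hq : 0 < q) (hr : 0 < r) {a : ℝ≥0∞} (ha : a ≠ ∞)
    (F : SpTime m → ℝ≥0∞) : mixedLp q r (fun p => a * F p) = a * mixedLp q r F := by
  have h (s : ℝ) (hs : 0 < s) : a ^ s ≠ ∞ := ENNReal.rpow_ne_top_of_nonneg hs.le ha
  have h' (s : ℝ) (hs : 0 < s) : (a ^ s) ^ (1 / s) = a := by
    rw [← ENNReal.rpow_mul, mul_one_div_cancel hs.ne', ENNReal.rpow_one]
  simp only [mixedLp, ENNReal.mul_rpow_of_nonneg _ _ hr.le, lintegral_const_mul' _ _ (h r hr),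
    ENNReal.mul_rpow_of_nonneg _ _ (one_div_pos.2 hr).le, h' r hr,
    ENNReal.mul_rpow_of_nonneg _ _ hq.le, lintegral_const_mul' _ _ (h q hq),
    ENNReal.mul_rpow_of_nonneg _ _ (one_div_pos.2 hq).le, h' q hq]

theorem mixedLp_add_le {m : ℕ} {q r : ℝ} (hq : 1 ≤ q) (hr : 1 ≤ r) {F G : SpTime m → ℝ≥0∞}
    (hF : Measurable F) (hG : Measurable G) :
    mixedLp q r (fun p => F p + G p) ≤ mixedLp q r F + mixedLp q r G := by
  have hm {H : SpTime m → ℝ≥0∞} (hH : Measurable H) :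
      Measurable fun t : ℝ => (∫⁻ x : Fin m → ℝ, H (t, x) ^ r) ^ (1 / r) :=
    (Measurable.lintegral_prod_right (hH.pow_const r)).pow_const _
  refine le_trans ?_
    (ENNReal.lintegral_Lp_add_le (hm hF).aemeasurable (hm hG).aemeasurable hq)
  unfold mixedLp
  gcongr with t
  exact ENNReal.lintegral_Lp_add_le (hF.comp measurable_prodMk_left).aemeasurable
    (hG.comp measurable_prodMk_left).aemeasurable hr

theorem mixedLp_sum_le {m : ℕ} {q r : ℝ} (hq : 1 ≤ q) (hr : 1 ≤ r) {ι : Type*} (s : Finset ι)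
    {F : ι → SpTime m → ℝ≥0∞} (hF : ∀ i, Measurable (F i)) :
    mixedLp q r (fun p => ∑ i ∈ s, F i p) ≤ ∑ i ∈ s, mixedLp q r (F i) := by
  classical
  induction s using Finset.induction_on with
  | empty =>
    have hq0 : 0 < q := by linarith
    have hr0 : 0 < r := by linarith
    simp [mixedLp, hq0, hr0]
  | insert i s hi ih =>
    simp only [Finset.sum_insert hi]
    exact (mixedLp_add_le hq hr (hF i) (Finset.measurable_fun_sum s fun i _ => hF i)).trans
      (by gcongr)

open Classical in
/-- If every point of `A` lies in at least `θ * N` of the sets `X 0, …, X (N - 1)`, then some `X k`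
captures a proportion `θ` of the mixed norm over `A`. -/
theorem exists_mul_mixedNormST_le {m : ℕ} {q r : ℝ} (hq : 1 ≤ q) (hr : 1 ≤ r)
    {F : SpTime m → ℝ≥0∞} (hF : Measurable F) {A : Set (SpTime m)} (hA : MeasurableSet A)
    {N : ℕ} (hN : 0 < N) {X : ℕ → Set (SpTime m)} (hX : ∀ k, MeasurableSet (X k)) {θ : ℝ}
    (h : ∀ p ∈ A, θ * N ≤ ((Finset.range N).filter fun k => p ∈ X k).card) :
    ∃ k < N, ENNReal.ofReal θ * mixedNormST q r A F ≤ mixedNormST q r (A ∩ X k) F := by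
  have hq0 : 0 < q := by linarith
  have hr0 : 0 < r := by linarith
  simp only [mixedNormST_eq_mixedLp hr0]
  obtain ⟨k, hk, hmax⟩ := (Finset.range N).exists_max_image
    (fun k => mixedLp q r ((A ∩ X k).indicator F)) ⟨0, Finset.mem_range.2 hN⟩
  refine ⟨k, Finset.mem_range.1 hk, ?_⟩
  have hpt : ∀ p, ENNReal.ofReal (θ * N) * A.indicator F p ≤
      ∑ k ∈ Finset.range N, (A ∩ X k).indicator F p := by
    intro p
    by_cases hp : p ∈ A
    · have hk (k : ℕ) : (A ∩ X k).indicator F p = if p ∈ X k then F p else 0 := by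
        simp [indicator_apply, hp]
      simp only [hk, ← Finset.sum_filter, Finset.sum_const, nsmul_eq_mul,
        indicator_of_mem hp]
      gcongr
      exact ENNReal.ofReal_le_of_le_toReal (by simpa using h p hp)
    · simp [hp]
  have h1 : ENNReal.ofReal (θ * N) * mixedLp q r (A.indicator F) ≤
      N * mixedLp q r ((A ∩ X k).indicator F) := by
    rw [← mixedLp_const_mul hq0 hr0 ENNReal.ofReal_ne_top]
    refine (mixedLp_mono hq0 hr0 hpt).trans ((mixedLp_sum_le hq hr _ fun k =>
      hF.indicator (hA.inter (hX k))).trans ((Finset.sum_le_card_nsmul _ _ _ hmax).trans ?_))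
    simp
  rw [mul_comm θ, ENNReal.ofReal_mul (by positivity), ENNReal.ofReal_natCast, mul_assoc] at h1
  exact (ENNReal.mul_le_mul_iff_right (by exact_mod_cast hN.ne') (ENNReal.natCast_ne_top N)).1 h1

open Classical in
/-- Translating along the diagonal by multiples of `R / N`, a given point of a cube of side `R`
is lost for few of the translates. -/
theorem card_not_mem_iInter_Iset_le {D M J K : ℕ} (hK : 0 < K) {R : ℝ} (hR : 0 < R)
    {εs rs : Fin M → ℝ} (hε : ∀ m, 0 < εs m) (hε' : ∀ m, εs m ≤ 1 / 4)
    (hJ : ∀ m, jscale (2 * R) (rs m) ≤ J) {c p : SpTime D} (hp : p ∈ cube c R) :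
    (((Finset.range (2 ^ J * K)).filter fun k : ℕ =>
      p ∉ ⋂ m, Iset (c.1 - k * (R / (2 ^ J * K : ℕ)), fun i => c.2 i - k * (R / (2 ^ J * K : ℕ)))
        (2 * R) (εs m) (rs m)).card : ℝ) ≤
      (D + 1) * ((∑ m, εs m) * (2 ^ J * K : ℕ) + M * 2 ^ J) := by
  let x : Option (Fin D) → ℝ := fun i => i.elim (p.1 - c.1) fun i => p.2 i - c.2 i
  have hx : ∀ i, 0 ≤ x i ∧ x i < R := by
    rintro (_ | i)
    · exact ⟨by simpa [x] using hp.1.1, by simpa [x, sub_lt_iff_lt_add'] using hp.1.2⟩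
    · exact ⟨by simpa [x] using (hp.2 i).1, by simpa [x, sub_lt_iff_lt_add'] using (hp.2 i).2⟩
  let bad : Fin M × Option (Fin D) → Finset ℕ := fun y =>
    (Finset.range (2 ^ J * K)).filter fun k : ℕ =>
      ¬ MemShrunkGrid (jscale (2 * R) (rs y.1)) (2 * R / 2 ^ jscale (2 * R) (rs y.1)) (εs y.1)
        (x y.2 + k * (R / (2 ^ J * K : ℕ)))
  calc _ ≤ (((Finset.univ.biUnion bad).card : ℕ) : ℝ) := by
        refine Nat.cast_le.2 (Finset.card_le_card fun k hk => ?_)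
        rw [Finset.mem_filter] at hk
        by_contra hcon
        simp only [Finset.mem_biUnion, Finset.mem_univ, true_and, not_exists, bad,
          Finset.mem_filter, not_and, not_not] at hcon
        refine hk.2 (mem_iInter.2 fun m => mem_Iset_iff.2 ⟨?_, fun i => ?_⟩)
        · convert hcon (m, none) hk.1 using 1
          simp only [x, Option.elim]; ring
        · convert hcon (m, some i) hk.1 using 1
          simp only [x, Option.elim]; ring
    _ ≤ ∑ y, ((bad y).card : ℝ) := by exact_mod_cast Finset.card_biUnion_le
    _ ≤ ∑ y : Fin M × Option (Fin D), (εs y.1 * (2 ^ J * K : ℕ) + 2 ^ J) :=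
        Finset.sum_le_sum fun y _ => card_not_memShrunkGrid_le (hJ y.1) hK hR (hε y.1) (hε' y.1)
          (hx y.2).1 (hx y.2).2
    _ = _ := by
        rw [Fintype.sum_prod_type]
        simp [← Finset.mul_sum, Finset.sum_add_distrib, Finset.sum_mul]
        ring

/-- Lemma 9.1 (Tao's cube averaging lemma). -/
theorem cube_averaging (d : ℕ) (hd : 1 ≤ d) (q r : ℝ) (hq : 1 ≤ q) (hr : 1 ≤ r)
    (R : ℝ) (hR : 0 < R) (c : SpTime (d - 1)) (M : ℕ) (hM : 1 ≤ M)
    (εs rs : Fin M → ℝ) (hε : ∀ m, 0 < εs m) (hrs : ∀ m, 0 < rs m)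
    (hrsle : ∀ m, rs m ≤ 2 * R) (hεsum : (∑ m, εs m) ≤ ((2 : ℝ) ^ (d + 1))⁻¹)
    (F : SpTime (d - 1) → ℝ≥0∞) (hF : Measurable F) :
    ∃ c' : SpTime (d - 1),
      cube c R ⊆ cube c' (2 * R) ∧
      cube c' (2 * R) ⊆ cube (c.1 - 3 * R / 2, fun i => c.2 i - 3 * R / 2) (4 * R) ∧
      mixedNormST q r (cube c R) F ≤
        ENNReal.ofReal (1 + 2 ^ (d + 1) * ∑ m, εs m) *
          mixedNormST q r (cube c R ∩ ⋂ m, Iset c' (2 * R) (εs m) (rs m)) F := by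
  obtain ⟨D, rfl⟩ : ∃ D, d = D + 1 := ⟨d - 1, by omega⟩
  classical
  set S := ∑ m, εs m with hS
  have hle : ∀ m, εs m ≤ S := fun m =>
    Finset.single_le_sum (fun i _ => (hε i).le) (Finset.mem_univ m)
  have hS0 : 0 < S := (hε ⟨0, hM⟩).trans_le (hle _)
  have hpow : (D + 1 : ℝ) ≤ 2 ^ D := by exact_mod_cast Nat.lt_two_pow_self
  have hS2 : 2 ^ D * S ≤ 1 / 4 := by
    rw [le_inv_comm₀ hS0 (by positivity), ← one_div, le_div_iff₀ hS0] at hεsum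
    rw [pow_succ, pow_succ] at hεsum
    linarith
  have hS4 : S ≤ 1 / 4 := by nlinarith [one_le_pow₀ (M₀ := ℝ) (a := 2) (n := D) (by norm_num)]
  obtain ⟨K, hK⟩ := exists_nat_gt (M / S)
  have hK0 : 0 < K := by
    have : (0 : ℝ) < K := lt_of_le_of_lt (by positivity) hK
    exact_mod_cast this
  rw [div_lt_iff₀ hS0] at hK
  set J := ∑ m, jscale (2 * R) (rs m)
  have hJ : ∀ m, jscale (2 * R) (rs m) ≤ J := fun m =>
    Finset.single_le_sum (f := fun m => jscale (2 * R) (rs m)) (fun _ _ => Nat.zero_le _)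
      (Finset.mem_univ m)
  have hbad := fun p (hp : p ∈ cube c R) =>
    card_not_mem_iInter_Iset_le hK0 hR hε (fun m => (hle m).trans hS4) hJ hp
  have hMN : (M : ℝ) * 2 ^ J ≤ S * (2 ^ J * K : ℕ) := by
    push_cast
    nlinarith [pow_pos (two_pos (α := ℝ)) J]
  have hN : 0 < 2 ^ J * K := by positivity
  generalize 2 ^ J * K = N at *
  have hN' : (0 : ℝ) < N := by exact_mod_cast hN
  obtain ⟨k, hk, hnorm⟩ := exists_mul_mixedNormST_le hq hr hF (measurableSet_cube c R) hN
    (X := fun k => ⋂ m, Iset (c.1 - k * (R / N), fun i => c.2 i - k * (R / N))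
      (2 * R) (εs m) (rs m))
    (fun k => MeasurableSet.iInter fun m => measurableSet_Iset _ _ _ _)
    (θ := 1 - 2 * (2 ^ D * S)) (fun p hp => by
      have h1 := Finset.card_filter_add_card_filter_not (s := Finset.range N) (fun k : ℕ =>
        p ∈ ⋂ m, Iset (c.1 - k * (R / N), fun i => c.2 i - k * (R / N)) (2 * R) (εs m) (rs m))
      rw [Finset.card_range] at h1
      have h2 : (_ : ℝ) = N := congrArg (Nat.cast (R := ℝ)) h1
      rw [Nat.cast_add] at h2
      have h3 : (D + 1 : ℝ) * (S * N + M * 2 ^ J) ≤ 2 ^ D * (2 * (S * N)) := by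
        gcongr; linarith
      have h4 := (hbad p hp).trans h3
      linarith)
  have hk0 : 0 ≤ k * (R / N) := by positivity
  have hkR : k * (R / N) ≤ R := by
    rw [← mul_div_assoc, div_le_iff₀ hN', mul_comm]
    gcongr
  refine ⟨(c.1 - k * (R / N), fun i => c.2 i - k * (R / N)), ?_, ?_, ?_⟩
  · rintro p ⟨⟨h1, h2⟩, h3⟩
    refine ⟨⟨?_, ?_⟩, fun i => ⟨?_, ?_⟩⟩ <;> dsimp only
    · linarith
    · linarith
    · linarith [(h3 i).1]
    · linarith [(h3 i).2]
  · rintro p ⟨⟨h1, h2⟩, h3⟩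
    dsimp only at h1 h2 h3
    refine ⟨⟨?_, ?_⟩, fun i => ⟨?_, ?_⟩⟩ <;> dsimp only
    · linarith
    · linarith
    · linarith [(h3 i).1]
    · linarith [(h3 i).2]
  · calc mixedNormST q r (cube c R) F
        ≤ ENNReal.ofReal ((1 + 2 ^ (D + 1 + 1) * S) * (1 - 2 * (2 ^ D * S))) *
            mixedNormST q r (cube c R) F := by
          refine le_mul_of_one_le_left' (ENNReal.one_le_ofReal.2 ?_)
          have h0 : 0 < 2 ^ D * S := by positivity
          have : (2 : ℝ) ^ (D + 1 + 1) * S = 4 * (2 ^ D * S) := by ring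
          rw [this]
          nlinarith
      _ ≤ _ := by
          rw [ENNReal.ofReal_mul (by positivity), mul_assoc]
          gcongr


end
end
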